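/- Let ‖·‖ be a norm on ℝ² which is strictly convex (x ↦ ‖x‖² is strictly convex) and C^{1,1} on ℝ²∖{0} (differentiable with locally Lipschitz derivative). Let d_SF be the associated sub-Finsler distance on the Heisenberg group ℝ³, and let 𝔪 = f·ℒ³ where f : ℝ³ → ℝ is smooth (C^∞) and everywhere positive. Then for every K ∈ ℝ and every N ∈ (1,∞) the Brunn–Minkowski inequality BM(K,N) fails: there exist nonempty Borel sets A, B ⊆ ℝ³ and t ∈ (0,1) such that 𝔪(M_t(A,B))^{1/N} < τ^{(1−t)}_{K,N}(Θ(A,B))·𝔪(A)^{1/N} + τ^{(t)}_{K,N}(Θ(A,B))·𝔪(B)^{1/N}. -/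

import Mathlib

open MeasureTheory

/-- A (symmetric) norm on `ℝ × ℝ`. -/
structure IsNorm2 (nrm : ℝ × ℝ → ℝ) : Prop where
  eq_zero_iff : ∀ x, nrm x = 0 ↔ x = 0
  smul_eq : ∀ (a : ℝ) (x : ℝ × ℝ), nrm (a • x) = |a| * nrm x
  triangle : ∀ x y, nrm (x + y) ≤ nrm x + nrm y

/-- `nrm` is `C^{1,1}` on `ℝ² ∖ {0}`: differentiable there, with locally Lipschitz derivative. -/
def IsC11Away (nrm : ℝ × ℝ → ℝ) : Prop :=
  DifferentiableOn ℝ nrm {x | x ≠ 0} ∧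
    ∀ x : ℝ × ℝ, x ≠ 0 → ∃ ε > (0:ℝ), ∃ K : NNReal,
      LipschitzOnWith K (fderiv ℝ nrm) (Metric.ball x ε \ {0})

/-- `γ` is a horizontal Lipschitz curve joining `p` to `q`, with a.e. derivative `g`. -/
def IsAdmissible (γ g : ℝ → ℝ × ℝ × ℝ) (p q : ℝ × ℝ × ℝ) : Prop :=
  (∃ K : NNReal, LipschitzOnWith K γ (Set.Icc 0 1)) ∧ γ 0 = p ∧ γ 1 = q ∧
    ∀ᵐ t ∂(volume.restrict (Set.Icc (0:ℝ) 1)),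
      HasDerivAt γ (g t) t ∧
      (g t).2.2 = ((γ t).1 * (g t).2.1 - (γ t).2.1 * (g t).1) / 2

/-- Length of a horizontal curve with derivative `g`, w.r.t. the norm `nrm`. -/
noncomputable def curveLength (nrm : ℝ × ℝ → ℝ) (g : ℝ → ℝ × ℝ × ℝ) : ℝ :=
  ∫ t in Set.Icc (0:ℝ) 1, nrm ((g t).1, (g t).2.1)

/-- The sub-Finsler distance on the Heisenberg group associated with the norm `nrm`. -/
noncomputable def dSF (nrm : ℝ × ℝ → ℝ) (p q : ℝ × ℝ × ℝ) : ℝ :=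
  sInf {L | ∃ γ g, IsAdmissible γ g p q ∧ L = curveLength nrm g}

/-- The set of `t`-midpoints of `A` and `B` w.r.t. the distance function `d`. -/
def midpoints {X : Type*} (d : X → X → ℝ) (t : ℝ) (A B : Set X) : Set X :=
  {x | ∃ a ∈ A, ∃ b ∈ B, d a x = t * d a b ∧ d x b = (1 - t) * d a b}

/-- `Θ(A,B)`: the infimum of distances between `A` and `B` if `K ≥ 0`, the supremum
otherwise. -/
noncomputable def Theta {X : Type*} (d : X → X → ℝ) (K : ℝ) (A B : Set X) : ℝ :=
  if 0 ≤ K then sInf {r | ∃ a ∈ A, ∃ b ∈ B, r = d a b}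
  else sSup {r | ∃ a ∈ A, ∃ b ∈ B, r = d a b}

/-- The distortion coefficient `σ_{K,N}^{(t)}(θ)`, with value `+∞` when `Kθ² ≥ Nπ²`. -/
noncomputable def sigmaCoeff (K N t θ : ℝ) : ENNReal :=
  if K * θ ^ 2 = 0 then ENNReal.ofReal t
  else if K < 0 then
    ENNReal.ofReal (Real.sinh (t * θ * Real.sqrt (-K / N)) / Real.sinh (θ * Real.sqrt (-K / N)))
  else if K * θ ^ 2 < N * Real.pi ^ 2 then
    ENNReal.ofReal (Real.sin (t * θ * Real.sqrt (K / N)) / Real.sin (θ * Real.sqrt (K / N)))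
  else ⊤

/-- The distortion coefficient `τ_{K,N}^{(t)}(θ) = t^{1/N} (σ_{K,N-1}^{(t)}(θ))^{1-1/N}`. -/
noncomputable def tauCoeff (K N t θ : ℝ) : ENNReal :=
  ENNReal.ofReal t ^ (1 / N : ℝ) * sigmaCoeff K (N - 1) t θ ^ (1 - 1 / N : ℝ)

open Filter Topology Set

namespace IsNorm2

variable {nrm : ℝ × ℝ → ℝ}

lemma map_zero (h : IsNorm2 nrm) : nrm 0 = 0 := (h.eq_zero_iff 0).2 rfl

lemma map_neg (h : IsNorm2 nrm) (v : ℝ × ℝ) : nrm (-v) = nrm v := by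
  have := h.smul_eq (-1) v
  simpa using this

lemma nonneg (h : IsNorm2 nrm) (v : ℝ × ℝ) : 0 ≤ nrm v := by
  have := h.triangle v (-v)
  rw [h.map_neg, add_neg_cancel, h.map_zero] at this
  linarith

lemma pos (h : IsNorm2 nrm) {v : ℝ × ℝ} (hv : v ≠ 0) : 0 < nrm v :=
  lt_of_le_of_ne (h.nonneg v) fun h0 => hv ((h.eq_zero_iff v).1 h0.symm)

lemma exists_le_mul_norm (h : IsNorm2 nrm) : ∃ C, 0 ≤ C ∧ ∀ v, nrm v ≤ C * ‖v‖ := by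
  refine ⟨nrm (1, 0) + nrm (0, 1), add_nonneg (h.nonneg _) (h.nonneg _), fun v => ?_⟩
  have hv : v = v.1 • ((1, 0) : ℝ × ℝ) + v.2 • ((0, 1) : ℝ × ℝ) := by ext <;> simp
  calc nrm v = nrm (v.1 • ((1, 0) : ℝ × ℝ) + v.2 • ((0, 1) : ℝ × ℝ)) := by rw [← hv]
    _ ≤ |v.1| * nrm (1, 0) + |v.2| * nrm (0, 1) := by
      rw [← h.smul_eq, ← h.smul_eq]; exact h.triangle _ _
    _ ≤ ‖v‖ * nrm (1, 0) + ‖v‖ * nrm (0, 1) := by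
      have h1 := h.nonneg (1, 0)
      have h2 := h.nonneg (0, 1)
      gcongr
      · exact norm_fst_le v
      · exact norm_snd_le v
    _ = _ := by ring

lemma continuous (h : IsNorm2 nrm) : Continuous nrm := by
  obtain ⟨C, hC0, hC⟩ := h.exists_le_mul_norm
  have key : ∀ v w, nrm v - nrm w ≤ C * ‖v - w‖ := fun v w => by
    have := h.triangle (v - w) w
    rw [sub_add_cancel] at this
    linarith [hC (v - w)]
  refine (LipschitzWith.of_dist_le_mul (K := ⟨C, hC0⟩) fun v w => ?_).continuous
  rw [Real.dist_eq, dist_eq_norm, abs_le]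
  have h1 := key v w
  have h2 := key w v
  rw [norm_sub_rev] at h2
  constructor
  · change -(C * _) ≤ _
    linarith
  · exact h1

lemma add_lt (h : IsNorm2 nrm) (hs : StrictConvexOn ℝ univ fun x => (nrm x) ^ 2)
    {v w : ℝ × ℝ} (hv : v ≠ 0) (hw : w ≠ 0) (hne : (nrm v)⁻¹ • v ≠ (nrm w)⁻¹ • w) :
    nrm (v + w) < nrm v + nrm w := by
  have ha := h.pos hv
  have hb := h.pos hw
  have hab := add_pos ha hb
  have key := hs.2 (mem_univ _) (mem_univ _) hne (div_pos ha hab) (div_pos hb hab)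
    (by field_simp)
  have e1 : (nrm v / (nrm v + nrm w)) • (nrm v)⁻¹ • v +
      (nrm w / (nrm v + nrm w)) • (nrm w)⁻¹ • w = (nrm v + nrm w)⁻¹ • (v + w) := by
    rw [smul_smul, smul_smul, smul_add]
    congr 2 <;> field_simp
  simp only [e1, h.smul_eq, smul_eq_mul, abs_inv, abs_of_pos ha, abs_of_pos hb,
    abs_of_pos hab, inv_mul_cancel₀ ha.ne', inv_mul_cancel₀ hb.ne', one_pow, mul_one] at key
  rw [← add_div, div_self hab.ne'] at key
  have h3 : (nrm v + nrm w)⁻¹ * nrm (v + w) < 1 := by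
    have h0 : 0 ≤ (nrm v + nrm w)⁻¹ * nrm (v + w) :=
      mul_nonneg (inv_nonneg.2 hab.le) (h.nonneg _)
    nlinarith
  rwa [inv_mul_lt_iff₀ hab, mul_one] at h3

lemma hasDerivAt_line (h3 : IsC11Away nrm) (s : ℝ) :
    HasDerivAt (fun s => nrm (1, s)) (fderiv ℝ nrm (1, s) (0, 1)) s := by
  have hne : ((1, s) : ℝ × ℝ) ≠ 0 := fun h => one_ne_zero (congrArg Prod.fst h)
  have hd : DifferentiableAt ℝ nrm (1, s) :=
    (h3.1 _ hne).differentiableAt (isOpen_ne.mem_nhds hne)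
  exact hd.hasFDerivAt.comp_hasDerivAt s ((hasDerivAt_const s (1 : ℝ)).prodMk (hasDerivAt_id s))

/-- Some line has a point at which the norm has a positive second derivative. -/
lemma exists_pos_second_deriv (h : IsNorm2 nrm)
    (hs : StrictConvexOn ℝ univ fun x => (nrm x) ^ 2) (h3 : IsC11Away nrm) :
    ∃ s k : ℝ, 0 < k ∧ HasDerivAt (fun s => fderiv ℝ nrm (1, s) (0, 1)) k s := by
  obtain ⟨ε, hε, K, hK⟩ := h3.2 (1, 0) fun h => one_ne_zero (congrArg Prod.fst h)
  set h' : ℝ → ℝ := fun s => fderiv ℝ nrm (1, s) (0, 1) with hh'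
  set δ := ε / 2 with hδ
  have hδ0 : 0 < δ := by positivity
  have hlip : LipschitzOnWith K h' (Icc (-δ) δ) := by
    have hmem : ∀ s ∈ Icc (-δ) δ, ((1, s) : ℝ × ℝ) ∈ Metric.ball ((1, 0) : ℝ × ℝ) ε \ {0} := by
      intro s hs
      refine ⟨?_, fun h => one_ne_zero (congrArg Prod.fst h)⟩
      rw [Metric.mem_ball, Prod.dist_eq]
      simp only [dist_self, Real.dist_eq, sub_zero]
      have : |s| ≤ δ := abs_le.2 hs
      exact max_lt hε (by linarith)
    refine LipschitzOnWith.of_dist_le_mul fun s hs t ht => ?_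
    have h1 := hK.dist_le_mul _ (hmem s hs) _ (hmem t ht)
    have h2 : dist ((1, s) : ℝ × ℝ) (1, t) = dist s t := by
      rw [Prod.dist_eq]; simp
    rw [h2] at h1
    refine le_trans ?_ h1
    rw [dist_eq_norm, dist_eq_norm, hh']
    have h4 := (fderiv ℝ nrm (1, s) - fderiv ℝ nrm (1, t)).le_opNorm (0, 1)
    have h5 : ‖((0, 1) : ℝ × ℝ)‖ = 1 := by simp
    rw [h5, mul_one] at h4
    exact h4
  by_contra! hcon
  have hder : ∀ s, deriv h' s ≤ 0 := fun s => by
    by_cases hd : DifferentiableAt ℝ h' s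
    · by_contra! hpos
      exact hcon s _ hpos hd.hasDerivAt
    · rw [deriv_zero_of_not_differentiableAt hd]
  have hanti : ∀ p q, -δ ≤ p → p ≤ q → q ≤ δ → h' q ≤ h' p := fun p q hp hpq hq => by
    have hac : AbsolutelyContinuousOnInterval h' p q := by
      refine LipschitzOnWith.absolutelyContinuousOnInterval (K := K) (hlip.mono ?_)
      rw [uIcc_of_le hpq]
      exact Icc_subset_Icc hp hq
    have h1 := hac.integral_deriv_eq_sub
    have h2 : ∫ x in p..q, deriv h' x ≤ 0 := by
      have := intervalIntegral.integral_nonneg (f := fun x => - deriv h' x) (μ := volume) hpq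
        fun x _ => neg_nonneg.2 (hder x)
      rw [intervalIntegral.integral_neg] at this
      linarith
    linarith
  have hcont : Continuous fun s => nrm (1, s) := h.continuous.comp (by fun_prop)
  obtain ⟨c₁, hc₁, e₁⟩ := exists_hasDerivAt_eq_slope (fun s => nrm (1, s)) h'
    (neg_lt_zero.2 hδ0) hcont.continuousOn fun s _ => hasDerivAt_line h3 s
  obtain ⟨c₂, hc₂, e₂⟩ := exists_hasDerivAt_eq_slope (fun s => nrm (1, s)) h' hδ0
    hcont.continuousOn fun s _ => hasDerivAt_line h3 s
  have hc := hanti c₁ c₂ hc₁.1.le (hc₁.2.trans hc₂.1).le hc₂.2.le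
  rw [e₁, e₂, sub_zero, zero_sub, neg_neg, div_le_div_iff_of_pos_right hδ0] at hc
  have hne : ∀ s : ℝ, ((1, s) : ℝ × ℝ) ≠ 0 := fun s h => one_ne_zero (congrArg Prod.fst h)
  have hlt := h.add_lt hs (hne δ) (hne (-δ)) (fun heq => by
    have h1 := congrArg Prod.fst heq
    have h2 := congrArg Prod.snd heq
    simp only [Prod.smul_fst, Prod.smul_snd, smul_eq_mul, mul_one] at h1 h2
    rw [← h1] at h2
    have := mul_pos (inv_pos.2 (h.pos (hne δ))) hδ0
    linarith)
  have h2 : nrm ((1, δ) + (1, -δ)) = 2 * nrm (1, 0) := by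
    have := h.smul_eq 2 (1, 0)
    rw [abs_of_pos two_pos] at this
    rw [← this]
    congr 1
    ext <;> simp; norm_num
  linarith

end IsNorm2

/-- Second order Taylor expansion with Peano remainder. -/
lemma tendsto_taylor_two {h h' : ℝ → ℝ} {a k : ℝ} (hh : ∀ s, HasDerivAt h (h' s) s)
    (hk : HasDerivAt h' k a) :
    Tendsto (fun τ => (h (a + τ) - h a - h' a * τ) / τ ^ 2) (𝓝[≠] 0) (𝓝 (k / 2)) := by
  have h1 : ∀ τ, HasDerivAt (fun τ => h (a + τ) - h a - h' a * τ) (h' (a + τ) - h' a) τ :=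
    fun τ => by
      have := (((hh (a + τ)).comp_const_add a τ).sub_const (h a)).sub
        ((hasDerivAt_id τ).const_mul (h' a))
      rw [mul_one] at this
      exact this
  have h2 : ∀ τ : ℝ, HasDerivAt (fun τ => τ ^ 2) (2 * τ) τ := fun τ => by
    simpa using hasDerivAt_pow 2 τ
  refine HasDerivAt.lhopital_zero_nhdsNE (f' := fun τ => h' (a + τ) - h' a)
    (g' := fun τ => 2 * τ) (Eventually.of_forall h1) (Eventually.of_forall h2) ?_ ?_ ?_ ?_
  · filter_upwards [self_mem_nhdsWithin] with τ hτ
    exact mul_ne_zero two_ne_zero hτ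
  · have := (h1 0).continuousAt.tendsto
    simp only [add_zero, sub_self, mul_zero] at this
    exact this.mono_left nhdsWithin_le_nhds
  · have := (h2 0).continuousAt.tendsto
    simp only [ne_eq, OfNat.ofNat_ne_zero, not_false_eq_true, zero_pow] at this
    exact this.mono_left nhdsWithin_le_nhds
  · have := (hasDerivAt_iff_tendsto_slope_zero.1 hk).div_const 2
    refine this.congr fun τ => ?_
    rw [smul_eq_mul]
    ring

/-- A basis in which the norm has the expansion `‖e + s f‖ = 1 + s² / 2 + o(s²)`. -/
lemma IsNorm2.exists_basis {nrm : ℝ × ℝ → ℝ} (h : IsNorm2 nrm)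
    (hs : StrictConvexOn ℝ univ fun x => (nrm x) ^ 2) (h3 : IsC11Away nrm) :
    ∃ e f : ℝ × ℝ, e.1 * f.2 - e.2 * f.1 ≠ 0 ∧ nrm e = 1 ∧
      Tendsto (fun s : ℝ => (nrm (e + s • f) - 1) / s ^ 2) (𝓝[≠] 0) (𝓝 (1 / 2)) := by
  obtain ⟨s₀, k, hk, hd⟩ := h.exists_pos_second_deriv hs h3
  set b := fderiv ℝ nrm (1, s₀) (0, 1) with hb
  set h0 := nrm (1, s₀) with hh0
  have h0pos : 0 < h0 := h.pos fun h => one_ne_zero (congrArg Prod.fst h)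
  set L := √(k * h0) with hL
  have hLpos : 0 < L := Real.sqrt_pos.2 (mul_pos hk h0pos)
  have hL2 : L ^ 2 = k * h0 := Real.sq_sqrt (mul_pos hk h0pos).le
  have hT := tendsto_taylor_two (fun s => hasDerivAt_line h3 s) hd
  refine ⟨h0⁻¹ • (1, s₀), L⁻¹ • ((0, 1) - (b / h0) • (1, s₀)), ?_, ?_, ?_⟩
  · simp only [Prod.smul_fst, Prod.smul_snd, smul_eq_mul, Prod.fst_sub, Prod.snd_sub]
    have : h0⁻¹ * 1 * (L⁻¹ * (1 - b / h0 * s₀)) - h0⁻¹ * s₀ * (L⁻¹ * (0 - b / h0 * 1))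
      = h0⁻¹ * L⁻¹ := by ring
    rw [this]
    positivity
  · rw [h.smul_eq, abs_of_pos (inv_pos.2 h0pos), ← hh0, inv_mul_cancel₀ h0pos.ne']
  · set v : ℝ → ℝ := fun s => (1 - s / L * b) / h0 with hv
    have hvc : Tendsto v (𝓝[≠] 0) (𝓝 h0⁻¹) := by
      have : Continuous v := by fun_prop
      have := this.tendsto 0
      simp only [hv, zero_div, zero_mul, sub_zero, one_div] at this
      exact this.mono_left nhdsWithin_le_nhds
    have hvpos : ∀ᶠ s in 𝓝[≠] 0, 0 < v s := hvc.eventually (lt_mem_nhds (inv_pos.2 h0pos))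
    have hτ : Tendsto (fun s => s / L / v s) (𝓝[≠] 0) (𝓝[≠] 0) := by
      refine tendsto_nhdsWithin_iff.2 ⟨?_, ?_⟩
      · have h1 : Tendsto (fun s : ℝ => s / L) (𝓝[≠] 0) (𝓝 0) := by
          have : Continuous fun s : ℝ => s / L := by fun_prop
          have := this.tendsto 0
          rw [zero_div] at this
          exact this.mono_left nhdsWithin_le_nhds
        have := h1.div hvc (inv_pos.2 h0pos).ne'
        rwa [zero_div] at this
      · filter_upwards [hvpos, self_mem_nhdsWithin] with s h1 h2
        exact div_ne_zero (div_ne_zero h2 hLpos.ne') h1.ne'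
    have hlim := ((hT.comp hτ).div hvc (inv_pos.2 h0pos).ne').div_const (L ^ 2)
    have hval : k / 2 / h0⁻¹ / L ^ 2 = 1 / 2 := by
      rw [hL2]; field_simp
    rw [hval] at hlim
    refine hlim.congr' ?_
    filter_upwards [hvpos, self_mem_nhdsWithin] with s h1 h2
    have h2' : s ≠ 0 := h2
    have e1 : h0⁻¹ • ((1, s₀) : ℝ × ℝ) + s • L⁻¹ • ((0, 1) - (b / h0) • ((1, s₀) : ℝ × ℝ))
        = v s • ((1, s₀ + s / L / v s) : ℝ × ℝ) := by
      ext
      · simp [hv]; field_simp; ring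
      · simp only [Prod.snd_add, Prod.smul_snd, smul_eq_mul, Prod.snd_sub]
        rw [mul_add, mul_div_cancel₀ _ h1.ne', hv]
        field_simp
        ring
    rw [e1, h.smul_eq, abs_of_pos h1]
    simp only [Function.comp_apply, Pi.div_apply]
    rw [← hh0, ← hb]
    have e2 : v s * h0 = 1 - s / L * b := by rw [hv]; field_simp
    generalize nrm (1, s₀ + s / L / v s) = n
    rw [div_div, div_div, div_eq_div_iff (by positivity) (by positivity)]
    have e3 : (v s * n - 1) = v s * (n - h0 - b * (s / L / v s)) := by
      field_simp
      field_simp at e2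
      linear_combination e2
    rw [e3]
    field_simp

/-- The expansion along a basis gives an upper bound in a cone around the first vector. -/
lemma IsNorm2.exists_upper_bound {nrm : ℝ × ℝ → ℝ} (h : IsNorm2 nrm) {e f : ℝ × ℝ}
    (he : nrm e = 1)
    (hT : Tendsto (fun s : ℝ => (nrm (e + s • f) - 1) / s ^ 2) (𝓝[≠] 0) (𝓝 (1 / 2)))
    {η : ℝ} (hη : 0 < η) :
    ∃ s₀ > 0, ∀ x y, 0 < x → |y| ≤ s₀ * x →
      nrm (x • e + y • f) ≤ x + (1 + η) / 2 * (y ^ 2 / x) := by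
  have h1 : ∀ᶠ s in 𝓝[≠] (0 : ℝ), (nrm (e + s • f) - 1) / s ^ 2 < (1 + η) / 2 :=
    hT.eventually (gt_mem_nhds (by linarith))
  rw [eventually_nhdsWithin_iff, Metric.eventually_nhds_iff] at h1
  obtain ⟨δ, hδ, h1⟩ := h1
  refine ⟨δ / 2, by positivity, fun x y hx hy => ?_⟩
  have e1 : x • e + y • f = x • (e + (y / x) • f) := by
    rw [smul_add, smul_smul, mul_div_cancel₀ _ hx.ne']
  rw [e1, h.smul_eq, abs_of_pos hx]
  have h2 : nrm (e + (y / x) • f) ≤ 1 + (1 + η) / 2 * (y / x) ^ 2 := by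
    by_cases h0 : y / x = 0
    · rw [h0]; simp [he]
    · have hlt : dist (y / x) 0 < δ := by
        rw [Real.dist_eq, sub_zero, abs_div, abs_of_pos hx, div_lt_iff₀ hx]
        nlinarith
      have := h1 hlt h0
      rw [div_lt_iff₀ (by positivity)] at this
      linarith
  calc x * nrm (e + (y / x) • f) ≤ x * (1 + (1 + η) / 2 * (y / x) ^ 2) := by gcongr
    _ = _ := by field_simp

/-- The covectors `(1 - (1 + η) β² / 2, β)` lie in the dual unit ball for small `β`. -/
lemma IsNorm2.exists_lower_bound {nrm : ℝ × ℝ → ℝ} (h : IsNorm2 nrm) {e f : ℝ × ℝ}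
    (he : nrm e = 1) (hf : f ≠ 0)
    (hT : Tendsto (fun s : ℝ => (nrm (e + s • f) - 1) / s ^ 2) (𝓝[≠] 0) (𝓝 (1 / 2)))
    {η : ℝ} (hη : 0 < η) :
    ∃ β₀ > 0, ∀ β, |β| ≤ β₀ → ∀ x y,
      (1 - (1 + η) / 2 * β ^ 2) * x + β * y ≤ nrm (x • e + y • f) := by
  have hη1 : 0 < 1 + η := by linarith
  set κ := (1 + η)⁻¹ with hκ
  have hκ0 : 0 < κ := inv_pos.2 hη1
  have hκη : κ * (1 + η) = 1 := inv_mul_cancel₀ hη1.ne'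
  have hκ1 : κ < 1 := inv_lt_one_of_one_lt₀ (by linarith)
  have h1 : ∀ᶠ s in 𝓝[≠] (0 : ℝ), κ / 2 < (nrm (e + s • f) - 1) / s ^ 2 :=
    hT.eventually (lt_mem_nhds (by linarith))
  rw [eventually_nhdsWithin_iff, Metric.eventually_nhds_iff] at h1
  obtain ⟨δ, hδ, h1⟩ := h1
  set s₀ := δ / 2 with hs₀
  have hs₀0 : 0 < s₀ := by positivity
  have hnear : ∀ s, |s| ≤ s₀ → 1 + κ / 2 * s ^ 2 ≤ nrm (e + s • f) := fun s hs => by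
    by_cases h0 : s = 0
    · rw [h0]; simp [he]
    · have hlt : dist s 0 < δ := by
        rw [Real.dist_eq, sub_zero]
        linarith
      have := h1 hlt h0
      rw [lt_div_iff₀ (by positivity)] at this
      linarith
  have hfar : ∀ s, s₀ < |s| → 1 + κ / 2 * s₀ * |s| ≤ nrm (e + s • f) := fun s hs => by
    have hs0 : 0 < |s| := hs₀0.trans hs
    set l := s₀ / |s| with hl
    have hl0 : 0 < l := by positivity
    have hl1 : l ≤ 1 := (div_le_one hs0).2 hs.le
    have e1 : e + (l * s) • f = (1 - l) • e + l • (e + s • f) := by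
      rw [smul_add, smul_smul, sub_smul, one_smul]; abel
    have habs : |l * s| = s₀ := by
      rw [abs_mul, abs_of_pos hl0, hl, div_mul_cancel₀ _ hs0.ne']
    have h2 := hnear (l * s) habs.le
    have h3 := h.triangle ((1 - l) • e) (l • (e + s • f))
    rw [← e1, h.smul_eq, h.smul_eq, abs_of_pos hl0, abs_of_nonneg (by linarith), he] at h3
    rw [← sq_abs, habs] at h2
    have h4 : l * (1 + κ / 2 * s₀ * |s|) ≤ l * nrm (e + s • f) := by
      have : l * |s| = s₀ := by rw [hl, div_mul_cancel₀ _ hs0.ne']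
      have e3 : l * (1 + κ / 2 * s₀ * |s|) = l + κ / 2 * s₀ * (l * |s|) := by ring
      rw [e3, this]
      nlinarith
    exact le_of_mul_le_mul_left h4 hl0
  refine ⟨min (min (κ * s₀ / 2) κ) (nrm f), lt_min (lt_min (by positivity) hκ0) (h.pos hf),
    fun β hβ => ?_⟩
  have hβ1 : |β| ≤ κ * s₀ / 2 := hβ.trans ((min_le_left _ _).trans (min_le_left _ _))
  have hβ2 : |β| ≤ κ := hβ.trans ((min_le_left _ _).trans (min_le_right _ _))
  have hβ3 : |β| ≤ nrm f := hβ.trans (min_le_right _ _)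
  have hα : 0 ≤ 1 - (1 + η) / 2 * β ^ 2 := by
    rw [← sq_abs]
    have : (1 + η) * |β| ^ 2 ≤ 1 := by
      calc (1 + η) * |β| ^ 2 ≤ (1 + η) * κ ^ 2 := by gcongr
        _ = κ := by linear_combination κ * hκη
        _ ≤ 1 := hκ1.le
    linarith
  have hone : ∀ b, |b| = |β| → ∀ s, (1 - (1 + η) / 2 * β ^ 2) + b * s ≤ nrm (e + s • f) := by
    intro b hb s
    rw [← sq_abs β, ← hb, sq_abs]
    rcases le_or_gt (|s|) s₀ with hs | hs
    · refine le_trans ?_ (hnear s hs)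
      have : 0 ≤ (1 + η) * (b - κ * s) ^ 2 := mul_nonneg hη1.le (sq_nonneg _)
      have e2 : (1 + η) * (b - κ * s) ^ 2 = (1 + η) * b ^ 2 - 2 * b * s + κ * s ^ 2 := by
        linear_combination (-2 * b * s + κ * s ^ 2) * hκη
      nlinarith
    · refine le_trans ?_ (hfar s hs)
      have h5 : b * s ≤ |b| * |s| := by rw [← abs_mul]; exact le_abs_self _
      have h6 : |b| * |s| ≤ κ * s₀ / 2 * |s| := by rw [hb]; gcongr
      have h7 : 0 ≤ (1 + η) / 2 * b ^ 2 := by positivity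
      linarith
  have hpos : ∀ b, |b| = |β| → ∀ x y, 0 < x →
      (1 - (1 + η) / 2 * β ^ 2) * x + b * y ≤ nrm (x • e + y • f) := by
    intro b hb x y hx
    have e1 : x • e + y • f = x • (e + (y / x) • f) := by
      rw [smul_add, smul_smul, mul_div_cancel₀ _ hx.ne']
    rw [e1, h.smul_eq, abs_of_pos hx]
    calc _ = x * ((1 - (1 + η) / 2 * β ^ 2) + b * (y / x)) := by field_simp
      _ ≤ _ := by gcongr; exact hone b hb _
  intro x y
  rcases lt_trichotomy x 0 with hx | hx | hx
  · have h8 := hpos (-β) (abs_neg _) (-x) (-y) (by linarith)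
    have e2 : (-x) • e + (-y) • f = -(x • e + y • f) := by
      rw [neg_smul, neg_smul, neg_add]
    rw [e2, h.map_neg] at h8
    nlinarith
  · subst hx
    rw [zero_smul, zero_add, mul_zero, zero_add, h.smul_eq]
    calc β * y ≤ |β| * |y| := by rw [← abs_mul]; exact le_abs_self _
      _ ≤ nrm f * |y| := by gcongr
      _ = _ := mul_comm _ _
  · exact hpos β rfl x y hx

/-- The linear automorphism of the Heisenberg group induced by a basis of `ℝ²`. -/
noncomputable def heisEquiv (e f : ℝ × ℝ) (hd : e.1 * f.2 - e.2 * f.1 ≠ 0) :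
    (ℝ × ℝ × ℝ) ≃ₗ[ℝ] (ℝ × ℝ × ℝ) where
  toFun p := (p.1 * e.1 + p.2.1 * f.1, p.1 * e.2 + p.2.1 * f.2,
    (e.1 * f.2 - e.2 * f.1) * p.2.2)
  invFun p := ((p.1 * f.2 - p.2.1 * f.1) / (e.1 * f.2 - e.2 * f.1),
    (e.1 * p.2.1 - e.2 * p.1) / (e.1 * f.2 - e.2 * f.1), p.2.2 / (e.1 * f.2 - e.2 * f.1))
  map_add' p q := by ext <;> simp <;> ring
  map_smul' c p := by ext <;> simp <;> ring
  left_inv p := by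
    ext
    · simp only; rw [div_eq_iff hd]; ring
    · simp only; rw [div_eq_iff hd]; ring
    · simp only; rw [div_eq_iff hd]; ring
  right_inv p := by
    ext
    · simp only
      rw [div_mul_eq_mul_div, div_mul_eq_mul_div, ← add_div, div_eq_iff hd]
      ring
    · simp only
      rw [div_mul_eq_mul_div, div_mul_eq_mul_div, ← add_div, div_eq_iff hd]
      ring
    · simp only; field_simp

lemma heisEquiv_apply (e f : ℝ × ℝ) (hd : e.1 * f.2 - e.2 * f.1 ≠ 0) (p : ℝ × ℝ × ℝ) :
    heisEquiv e f hd p = (p.1 * e.1 + p.2.1 * f.1, p.1 * e.2 + p.2.1 * f.2,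
      (e.1 * f.2 - e.2 * f.1) * p.2.2) := rfl

/-- A Lipschitz function whose derivative is bounded by `G` grows at most by `∫ G`. -/
lemma sub_le_integral_of_ae_deriv_le {u G : ℝ → ℝ} {K : NNReal}
    (hu : LipschitzOnWith K u (Icc 0 1)) (hG : IntegrableOn G (Icc (0 : ℝ) 1))
    (hG0 : ∀ t, 0 ≤ G t)
    (hder : ∀ᵐ t ∂(volume.restrict (Icc (0 : ℝ) 1)), ∃ u', HasDerivAt u u' t ∧ u' ≤ G t)
    {t : ℝ} (ht : t ∈ Icc (0 : ℝ) 1) : u t - u 0 ≤ ∫ t in Icc (0 : ℝ) 1, G t := by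
  have hsub : Icc 0 t ⊆ Icc (0 : ℝ) 1 := Icc_subset_Icc_right ht.2
  have hac : AbsolutelyContinuousOnInterval u 0 t := by
    refine LipschitzOnWith.absolutelyContinuousOnInterval (K := K) (hu.mono ?_)
    rwa [uIcc_of_le ht.1]
  rw [← hac.integral_deriv_eq_sub]
  have h1 : ∫ s in (0 : ℝ)..t, deriv u s ≤ ∫ s in (0 : ℝ)..t, G s := by
    refine intervalIntegral.integral_mono_ae_restrict ht.1 hac.intervalIntegrable_deriv ?_ ?_
    · rw [intervalIntegrable_iff_integrableOn_Icc_of_le ht.1]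
      exact hG.mono_set hsub
    · filter_upwards [ae_restrict_of_ae_restrict_of_subset hsub hder] with s hs
      obtain ⟨u', h1, h2⟩ := hs
      rwa [h1.deriv]
  refine h1.trans ?_
  rw [intervalIntegral.integral_of_le ht.1, ← integral_Icc_eq_integral_Ioc]
  exact setIntegral_mono_set hG (Eventually.of_forall hG0) hsub.eventuallyLE

lemma IsAdmissible.integrableOn {nrm : ℝ × ℝ → ℝ} (h : IsNorm2 nrm)
    {γ g : ℝ → ℝ × ℝ × ℝ} {p q : ℝ × ℝ × ℝ} (hγ : IsAdmissible γ g p q) :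
    IntegrableOn (fun t => nrm ((g t).1, (g t).2.1)) (Icc (0 : ℝ) 1) := by
  obtain ⟨⟨K, hK⟩, -, -, hder⟩ := hγ
  obtain ⟨C, hC0, hC⟩ := h.exists_le_mul_norm
  have hg : g =ᵐ[volume.restrict (Icc (0 : ℝ) 1)] deriv γ := by
    filter_upwards [hder] with t ht using ht.1.deriv.symm
  have hπ : Continuous fun v : ℝ × ℝ × ℝ => nrm (v.1, v.2.1) := h.continuous.comp (by fun_prop)
  have hmeas : AEStronglyMeasurable (fun t => nrm ((g t).1, (g t).2.1))
      (volume.restrict (Icc (0 : ℝ) 1)) :=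
    hπ.comp_aestronglyMeasurable ((aestronglyMeasurable_deriv γ _).congr hg.symm)
  have hinter : ∀ᵐ t ∂(volume.restrict (Icc (0 : ℝ) 1)), t ∈ Ioo (0 : ℝ) 1 := by
    rw [← restrict_Ioo_eq_restrict_Icc]
    exact ae_restrict_mem measurableSet_Ioo
  refine Integrable.of_bound (C := C * K) hmeas ?_
  filter_upwards [hg, hinter] with t h1 h2
  have h3 : ‖deriv γ t‖ ≤ K :=
    norm_deriv_le_of_lipschitzOn (Icc_mem_nhds h2.1 h2.2) hK
  rw [Real.norm_of_nonneg (h.nonneg _)]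
  refine (hC _).trans ?_
  gcongr
  rw [← h1] at h3
  refine le_trans ?_ h3
  rw [Prod.norm_def, Prod.norm_def, Prod.norm_def]
  exact max_le_max le_rfl (le_max_left _ _)

/-- The potential whose differential on the horizontal plane is
`(1 - (1 + η) (c₀ + c₁ x)² / 2) dx + (c₀ + c₁ x) dy`. -/
noncomputable def calib (η c₀ c₁ : ℝ) (p : ℝ × ℝ × ℝ) : ℝ :=
  p.1 - (1 + η) / 2 * (c₀ ^ 2 * p.1 + c₀ * c₁ * p.1 ^ 2 + c₁ ^ 2 * p.1 ^ 3 / 3) + c₀ * p.2.1 +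
    c₁ * (p.2.2 + p.1 * p.2.1 / 2)

lemma calib_le_curveLength {nrm : ℝ × ℝ → ℝ} (h : IsNorm2 nrm) {e f : ℝ × ℝ}
    (hd : e.1 * f.2 - e.2 * f.1 ≠ 0) {r η β₀ : ℝ} (hr : 0 < r) (hβ₀ : 0 < β₀)
    (hlow : ∀ β, |β| ≤ β₀ → ∀ x y,
      r * ((1 - (1 + η) / 2 * β ^ 2) * x + β * y) ≤ nrm (x • e + y • f))
    {γ g : ℝ → ℝ × ℝ × ℝ} {p q : ℝ × ℝ × ℝ}
    (hγ : IsAdmissible γ g (heisEquiv e f hd p) (heisEquiv e f hd q))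
    {R c₀ c₁ : ℝ} (hlen : curveLength nrm g ≤ r * R)
    (hc : |c₀| + |c₁| * (|p.1| + R) ≤ β₀) :
    r * (calib η c₀ c₁ q - calib η c₀ c₁ p) ≤ curveLength nrm g := by
  set Φ := heisEquiv e f hd with hΦ
  set Ψ : (ℝ × ℝ × ℝ) →L[ℝ] (ℝ × ℝ × ℝ) := LinearMap.toContinuousLinearMap Φ.symm.toLinearMap
    with hΨ
  have hΨΦ : ∀ v, Ψ (Φ v) = v := fun v => Φ.symm_apply_apply v
  have hΦΨ : ∀ v, Φ (Ψ v) = v := fun v => Φ.apply_symm_apply v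
  have hgint := hγ.integrableOn h
  obtain ⟨⟨K, hK⟩, hγ0, hγ1, hder⟩ := hγ
  set c : ℝ → ℝ × ℝ × ℝ := fun t => Ψ (γ t) with hcdef
  have hc0 : c 0 = p := by rw [hcdef]; simp only [hγ0]; exact hΨΦ p
  have hc1 : c 1 = q := by rw [hcdef]; simp only [hγ1]; exact hΨΦ q
  have hcl : LipschitzOnWith (‖Ψ‖₊ * K) c (Icc 0 1) := Ψ.lipschitz.comp_lipschitzOnWith hK
  have hcomp : IsCompact (c '' Icc 0 1) := isCompact_Icc.image_of_continuousOn hcl.continuousOn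
  have hlip : ∀ S : ℝ × ℝ × ℝ → ℝ, ContDiff ℝ 1 S →
      ∃ K', LipschitzOnWith K' (fun t => S (c t)) (Icc 0 1) := fun S hS => by
    obtain ⟨K', hK'⟩ := (hS.locallyLipschitz.locallyLipschitzOn
      (s := c '' Icc 0 1)).exists_lipschitzOnWith_of_compact hcomp
    exact ⟨_, hK'.comp hcl (mapsTo_image _ _)⟩
  have hnn : ∀ t, nrm ((g t).1, (g t).2.1) = nrm ((Ψ (g t)).1 • e + (Ψ (g t)).2.1 • f) :=
    fun t => by
      congr 1
      conv_lhs => rw [← hΦΨ (g t)]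
      rw [hΦ, heisEquiv_apply]
      ext <;> simp
  have hhor : ∀ᵐ t ∂(volume.restrict (Icc (0:ℝ) 1)), HasDerivAt c (Ψ (g t)) t ∧
      (Ψ (g t)).2.2 = ((c t).1 * (Ψ (g t)).2.1 - (c t).2.1 * (Ψ (g t)).1) / 2 := by
    filter_upwards [hder] with t ht
    refine ⟨Ψ.hasFDerivAt.comp_hasDerivAt t ht.1, ?_⟩
    have h2 := ht.2
    rw [← hΦΨ (g t), ← hΦΨ (γ t)] at h2
    rw [hΦ, heisEquiv_apply, heisEquiv_apply] at h2
    simp only at h2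
    refine mul_left_cancel₀ hd ?_
    rw [h2]
    simp only [hcdef]
    ring
  have hbound : ∀ S : ℝ × ℝ × ℝ → ℝ, ContDiff ℝ 1 S →
      (∀ᵐ t ∂(volume.restrict (Icc (0:ℝ) 1)), ∃ u', HasDerivAt (fun t => S (c t)) u' t ∧
        u' ≤ nrm ((g t).1, (g t).2.1)) →
      ∀ t ∈ Icc (0 : ℝ) 1, S (c t) - S p ≤ curveLength nrm g := fun S hS hS' t ht => by
    obtain ⟨K', hK'⟩ := hlip S hS
    have := sub_le_integral_of_ae_deriv_le hK' hgint (fun t => h.nonneg _) hS' ht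
    rwa [hc0] at this
  have hz : |(0 : ℝ)| ≤ β₀ := by rw [abs_zero]; exact hβ₀.le
  have hxle : ∀ x y, r * x ≤ nrm (x • e + y • f) := fun x y => by
    have := hlow 0 hz x y
    simpa using this
  have hrange : ∀ t ∈ Icc (0 : ℝ) 1, |(c t).1| ≤ |p.1| + R := fun t ht => by
    have h1 := hbound (fun v => r * v.1) (by fun_prop) (by
      filter_upwards [hhor] with s hs
      refine ⟨r * (Ψ (g s)).1, ?_, ?_⟩
      · exact (hasFDerivAt_fst.comp_hasDerivAt s hs.1).const_mul r
      · rw [hnn]; exact hxle _ _) t ht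
    have h2 := hbound (fun v => -(r * v.1)) (by fun_prop) (by
      filter_upwards [hhor] with s hs
      refine ⟨-(r * (Ψ (g s)).1), ?_, ?_⟩
      · exact ((hasFDerivAt_fst.comp_hasDerivAt s hs.1).const_mul r).neg
      · rw [hnn, ← h.map_neg, neg_add, ← neg_smul, ← neg_smul, ← mul_neg]
        exact hxle _ _) t ht
    have h3 : |(c t).1 - p.1| ≤ R := by
      rw [abs_le]
      constructor
      · refine le_of_mul_le_mul_left (a := r) ?_ hr
        linarith
      · refine le_of_mul_le_mul_left (a := r) ?_ hr
        linarith
    have h4 := abs_add_le ((c t).1 - p.1) p.1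
    rw [sub_add_cancel] at h4
    linarith
  have hfin := hbound (fun v => r * calib η c₀ c₁ v) (by unfold calib; fun_prop) (by
    filter_upwards [hhor, ae_restrict_mem measurableSet_Icc] with t ht htm
    have hx : HasDerivAt (fun t => (c t).1) (Ψ (g t)).1 t :=
      (hasFDerivAt_fst (p := c t)).comp_hasDerivAt t ht.1
    have hyz : HasDerivAt (fun t => (c t).2) (Ψ (g t)).2 t :=
      (hasFDerivAt_snd (p := c t)).comp_hasDerivAt t ht.1
    have hy : HasDerivAt (fun t => (c t).2.1) (Ψ (g t)).2.1 t := by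
      have h2 := (ContinuousLinearMap.fst ℝ ℝ ℝ).hasFDerivAt (x := (c t).2)
      exact HasFDerivAt.comp_hasDerivAt (f := fun t => (c t).2) t h2 hyz
    have hz' : HasDerivAt (fun t => (c t).2.2) (Ψ (g t)).2.2 t := by
      have h2 := (ContinuousLinearMap.snd ℝ ℝ ℝ).hasFDerivAt (x := (c t).2)
      exact HasFDerivAt.comp_hasDerivAt (f := fun t => (c t).2) t h2 hyz
    refine ⟨r * ((1 - (1 + η) / 2 * (c₀ + c₁ * (c t).1) ^ 2) * (Ψ (g t)).1 +
      (c₀ + c₁ * (c t).1) * (Ψ (g t)).2.1), ?_, ?_⟩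
    · have := (((hx.sub ((((hx.const_mul (c₀ ^ 2)).add ((hx.pow 2).const_mul (c₀ * c₁))).add
        (((hx.pow 3).const_mul (c₁ ^ 2)).div_const 3)).const_mul ((1 + η) / 2))).add
        (hy.const_mul c₀)).add ((hz'.add ((hx.mul hy).div_const 2)).const_mul c₁)).const_mul r
      refine this.congr_deriv ?_
      rw [ht.2]
      push_cast
      ring
    · rw [hnn]
      refine hlow _ ?_ _ _
      refine (abs_add_le _ _).trans (le_trans ?_ hc)
      rw [abs_mul]
      have := hrange t htm
      gcongr) 1 ⟨zero_le_one, le_rfl⟩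
  rw [hc1, ← mul_sub] at hfin
  exact hfin

lemma isAdmissible_heisEquiv {e f : ℝ × ℝ} (hd : e.1 * f.2 - e.2 * f.1 ≠ 0)
    {x y z x' y' z' : ℝ → ℝ} (hx : ContDiff ℝ 1 x) (hy : ContDiff ℝ 1 y) (hz : ContDiff ℝ 1 z)
    (hx' : ∀ t, HasDerivAt x (x' t) t) (hy' : ∀ t, HasDerivAt y (y' t) t)
    (hz' : ∀ t, HasDerivAt z (z' t) t) (hhor : ∀ t, z' t = (x t * y' t - y t * x' t) / 2)
    {p q : ℝ × ℝ × ℝ} (hp : (x 0, y 0, z 0) = p) (hq : (x 1, y 1, z 1) = q) :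
    IsAdmissible (fun t => heisEquiv e f hd (x t, y t, z t))
      (fun t => heisEquiv e f hd (x' t, y' t, z' t))
      (heisEquiv e f hd p) (heisEquiv e f hd q) := by
  subst hp hq
  set Φ : (ℝ × ℝ × ℝ) →L[ℝ] (ℝ × ℝ × ℝ) :=
    LinearMap.toContinuousLinearMap (heisEquiv e f hd).toLinearMap with hΦ
  have hc : ContDiff ℝ 1 fun t => Φ (x t, y t, z t) :=
    Φ.contDiff.comp (hx.prodMk (hy.prodMk hz))
  refine ⟨?_, rfl, rfl, Eventually.of_forall fun t => ⟨?_, ?_⟩⟩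
  · exact hc.locallyLipschitz.locallyLipschitzOn.exists_lipschitzOnWith_of_compact isCompact_Icc
  · exact Φ.hasFDerivAt.comp_hasDerivAt t ((hx' t).prodMk ((hy' t).prodMk (hz' t)))
  · simp only [heisEquiv_apply, hhor]
    ring

lemma curveLength_heisEquiv (nrm : ℝ × ℝ → ℝ) {e f : ℝ × ℝ}
    (hd : e.1 * f.2 - e.2 * f.1 ≠ 0) (x' y' z' : ℝ → ℝ) :
    curveLength nrm (fun t => heisEquiv e f hd (x' t, y' t, z' t)) =
      ∫ t in Icc (0 : ℝ) 1, nrm (x' t • e + y' t • f) := by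
  unfold curveLength
  congr 1

lemma hasDerivAt_quintic {F : ℝ → ℝ} (a b c d e k : ℝ)
    (hF : ∀ t, F t = a + b * t + c * t ^ 2 + d * t ^ 3 + e * t ^ 4 + k * t ^ 5) (t : ℝ) :
    HasDerivAt F (b + 2 * c * t + 3 * d * t ^ 2 + 4 * e * t ^ 3 + 5 * k * t ^ 4) t := by
  have h1 := (hasDerivAt_id t).const_mul b
  have h2 := (hasDerivAt_pow 2 t).const_mul c
  have h3 := (hasDerivAt_pow 3 t).const_mul d
  have h4 := (hasDerivAt_pow 4 t).const_mul e
  have h5 := (hasDerivAt_pow 5 t).const_mul k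
  rw [show F = fun t => a + b * t + c * t ^ 2 + d * t ^ 3 + e * t ^ 4 + k * t ^ 5 from funext hF]
  refine (((((h1.const_add a).add h2).add h3).add h4).add h5).congr_deriv ?_
  push_cast
  ring

lemma exists_isAdmissible {e f : ℝ × ℝ} (hd : e.1 * f.2 - e.2 * f.1 ≠ 0) (p q : ℝ × ℝ × ℝ) :
    ∃ γ g, IsAdmissible γ g (heisEquiv e f hd p) (heisEquiv e f hd q) := by
  obtain ⟨p₁, p₂, p₃⟩ := p
  obtain ⟨q₁, q₂, q₃⟩ := q
  obtain ⟨X, hX⟩ : ∃ X, X = q₁ - p₁ := ⟨_, rfl⟩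
  obtain ⟨Y, hY⟩ : ∃ Y, Y = q₂ - p₂ := ⟨_, rfl⟩
  obtain ⟨w, hw⟩ : ∃ w, w = 5 * Y - 30 * (q₃ - p₃ - (p₁ * q₂ - p₂ * q₁) / 2) := ⟨_, rfl⟩
  refine ⟨_, _, isAdmissible_heisEquiv hd
    (x := fun t => p₁ + X * t + (t - t ^ 2))
    (y := fun t => p₂ + Y * t + w * (t - 3 * t ^ 2 + 2 * t ^ 3))
    (z := fun t => p₃ + (p₁ * (Y * t + w * (t - 3 * t ^ 2 + 2 * t ^ 3)) -
      p₂ * (X * t + (t - t ^ 2))) / 2 + (X * w * (t ^ 4 - t ^ 3) + Y * t ^ 3 / 3 +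
        w * (-(2 / 3) * t ^ 3 + t ^ 4 - 2 / 5 * t ^ 5)) / 2)
    (by fun_prop) (by fun_prop) (by fun_prop)
    (hasDerivAt_quintic p₁ (X + 1) (-1) 0 0 0 fun t => by ring)
    (hasDerivAt_quintic p₂ (Y + w) (-3 * w) (2 * w) 0 0 fun t => by ring)
    (hasDerivAt_quintic p₃ ((p₁ * (Y + w) - p₂ * (X + 1)) / 2) ((p₁ * (-3 * w) + p₂) / 2)
      (p₁ * w - X * w / 2 + Y / 6 - w / 3) (X * w / 2 + w / 2) (-w / 5) fun t => by ring)
    (fun t => by ring) (by simp) (by ext <;> simp only [hw, hX, hY] <;> ring)⟩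

lemma dSF_nonneg {nrm : ℝ × ℝ → ℝ} (h : IsNorm2 nrm) (p q : ℝ × ℝ × ℝ) : 0 ≤ dSF nrm p q := by
  refine Real.sInf_nonneg ?_
  rintro _ ⟨γ, g, -, rfl⟩
  exact integral_nonneg fun t => h.nonneg _

lemma dSF_le_curveLength {nrm : ℝ × ℝ → ℝ} (h : IsNorm2 nrm) {p q : ℝ × ℝ × ℝ}
    {γ g : ℝ → ℝ × ℝ × ℝ} (hγ : IsAdmissible γ g p q) : dSF nrm p q ≤ curveLength nrm g := by
  refine csInf_le ⟨0, ?_⟩ ⟨γ, g, hγ, rfl⟩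
  rintro _ ⟨γ, g, -, rfl⟩
  exact integral_nonneg fun t => h.nonneg _

lemma calib_le_dSF {nrm : ℝ × ℝ → ℝ} (h : IsNorm2 nrm) {e f : ℝ × ℝ}
    (hd : e.1 * f.2 - e.2 * f.1 ≠ 0) {r η β₀ : ℝ} (hr : 0 < r) (hβ₀ : 0 < β₀)
    (hlow : ∀ β, |β| ≤ β₀ → ∀ x y,
      r * ((1 - (1 + η) / 2 * β ^ 2) * x + β * y) ≤ nrm (x • e + y • f))
    {p q : ℝ × ℝ × ℝ} {R c₀ c₁ : ℝ}
    (hlen : dSF nrm (heisEquiv e f hd p) (heisEquiv e f hd q) < r * R)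
    (hc : |c₀| + |c₁| * (|p.1| + R) ≤ β₀) :
    r * (calib η c₀ c₁ q - calib η c₀ c₁ p) ≤ dSF nrm (heisEquiv e f hd p) (heisEquiv e f hd q) := by
  by_contra! hlt
  obtain ⟨γ₀, g₀, h₀⟩ := exists_isAdmissible hd p q
  obtain ⟨_, ⟨γ, g, hγ, rfl⟩, hL⟩ := exists_lt_of_csInf_lt
    (s := {L | ∃ γ g, IsAdmissible γ g (heisEquiv e f hd p) (heisEquiv e f hd q) ∧
      L = curveLength nrm g}) ⟨_, γ₀, g₀, h₀, rfl⟩ (lt_min hlt hlen)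
  have := calib_le_curveLength h hd hr hβ₀ hlow hγ (hL.le.trans (min_le_right _ _)) hc
  exact absurd (hL.trans_le (min_le_left _ _)) this.not_gt

lemma dSF_le {nrm : ℝ × ℝ → ℝ} (h : IsNorm2 nrm) {e f : ℝ × ℝ}
    (hd : e.1 * f.2 - e.2 * f.1 ≠ 0) {r η s₀ : ℝ}
    (hup : ∀ x y, 0 < x → |y| ≤ s₀ * x → nrm (x • e + y • f) ≤ r * (x + (1 + η) / 2 * (y ^ 2 / x)))
    {p q : ℝ × ℝ × ℝ} {X Y Z : ℝ} (hX : q.1 - p.1 = X) (hY : q.2.1 - p.2.1 = Y)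
    (hZ : q.2.2 - p.2.2 - (p.1 * q.2.1 - p.2.1 * q.1) / 2 = Z) (hX0 : 0 < X)
    (hs : |Y| + |6 * Z / X| ≤ s₀ * X) :
    dSF nrm (heisEquiv e f hd p) (heisEquiv e f hd q) ≤
      r * (X + (1 + η) / 2 * (Y ^ 2 / X + 12 * Z ^ 2 / X ^ 3)) := by
  obtain ⟨p₁, p₂, p₃⟩ := p
  obtain ⟨q₁, q₂, q₃⟩ := q
  simp only at hX hY hZ
  obtain ⟨w, hw⟩ : ∃ w, w = -(6 * Z / X) := ⟨_, rfl⟩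
  have hwX : w * X = -6 * Z := by rw [hw]; field_simp
  have hx : ∀ t, HasDerivAt (fun t => p₁ + X * t) ((fun _ => X) t) t := fun t =>
    (hasDerivAt_quintic p₁ X 0 0 0 0 (fun t => by ring) t).congr_deriv (by ring)
  have hy : ∀ t, HasDerivAt (fun t => p₂ + Y * t + w * (t - t ^ 2))
      ((fun t => Y + w * (1 - 2 * t)) t) t := fun t =>
    (hasDerivAt_quintic p₂ (Y + w) (-w) 0 0 0 (fun t => by ring) t).congr_deriv (by ring)
  have key := isAdmissible_heisEquiv hd
    (x := fun t => p₁ + X * t)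
    (y := fun t => p₂ + Y * t + w * (t - t ^ 2))
    (z := fun t => p₃ + ((p₁ * Y - p₂ * X) * t + p₁ * w * (t - t ^ 2) - w * X * t ^ 3 / 3) / 2)
    (by fun_prop) (by fun_prop) (by fun_prop) hx hy
    (hasDerivAt_quintic p₃ ((p₁ * Y - p₂ * X + p₁ * w) / 2) (-(p₁ * w / 2)) (-(w * X / 6)) 0 0
      fun t => by ring) (fun t => by ring) (p := (p₁, p₂, p₃)) (q := (q₁, q₂, q₃)) (by simp)
    (by rw [hwX, ← hZ]; ext <;> simp only [← hX, ← hY] <;> ring)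
  refine (dSF_le_curveLength h key).trans ?_
  rw [curveLength_heisEquiv, integral_Icc_eq_integral_Ioc,
    ← intervalIntegral.integral_of_le zero_le_one]
  have hcont : Continuous fun t : ℝ => nrm (X • e + (Y + w * (1 - 2 * t)) • f) :=
    h.continuous.comp (by fun_prop)
  have hcont' : Continuous fun t : ℝ => r * (X + (1 + η) / 2 * ((Y + w * (1 - 2 * t)) ^ 2 / X)) := by
    fun_prop
  refine (intervalIntegral.integral_mono_on zero_le_one (hcont.intervalIntegrable _ _)
    (hcont'.intervalIntegrable _ _) fun t ht => hup _ _ hX0 ?_).trans (le_of_eq ?_)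
  · refine (abs_add_le _ _).trans (le_trans ?_ hs)
    rw [abs_mul]
    have h1 : |1 - 2 * t| ≤ 1 := by rw [abs_le]; constructor <;> linarith [ht.1, ht.2]
    have h2 : |w| = |6 * Z / X| := by rw [hw, abs_neg]
    rw [← h2]
    have := mul_le_mul_of_nonneg_left h1 (abs_nonneg w)
    linarith
  · rw [intervalIntegral.integral_eq_sub_of_hasDerivAt (f := fun t =>
      r * (X * t + (1 + η) / 2 / X * (Y ^ 2 * t + 2 * Y * w * (t - t ^ 2) +
        w ^ 2 * (t - 2 * t ^ 2 + 4 / 3 * t ^ 3)))) (fun t _ =>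
      (hasDerivAt_quintic 0 (r * (X + (1 + η) / 2 / X * (Y ^ 2 + 2 * Y * w + w ^ 2)))
        (r * ((1 + η) / 2 / X * (-(2 * Y * w) - 2 * w ^ 2)))
        (r * ((1 + η) / 2 / X * (4 / 3 * w ^ 2))) 0 0 (fun t => by ring) t).congr_deriv (by ring))
      (hcont'.intervalIntegrable _ _), hw]
    field_simp
    ring

noncomputable def primitiveSq (c₀ c₁ x : ℝ) : ℝ := c₀ ^ 2 * x + c₀ * c₁ * x ^ 2 + c₁ ^ 2 * x ^ 3 / 3

noncomputable def energyBound (ε : ℝ) (u v : ℝ × ℝ × ℝ) : ℝ :=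
  (v.2.1 - u.2.1) ^ 2 / (2 + ε * (v.1 - u.1)) +
    12 * (v.2.2 - u.2.2 + (u.2.1 + v.2.1) / 2 + ε * (u.2.1 * v.1 - u.1 * v.2.1) / 2) ^ 2 /
      (2 + ε * (v.1 - u.1)) ^ 3

/-- Upper bound for the displacement of a midpoint obtained by using the calibration
with coefficients `ε c₀, ε c₁` before the midpoint and `ε c₀', ε c₁'` after it. -/
noncomputable def midpointGap (c₀ c₁ c₀' c₁' ε η : ℝ) (u v : ℝ × ℝ × ℝ) (x : ℝ) : ℝ :=
  (1 + η) / 2 * energyBound ε u v +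
    (1 + η) / 2 * (primitiveSq c₀ c₁ (ε * x) - primitiveSq c₀ c₁ (-1 + ε * u.1) +
      primitiveSq c₀' c₁' (1 + ε * v.1) - primitiveSq c₀' c₁' (ε * x)) +
    c₀ * u.2.1 + c₁ * (u.2.2 + (-1 + ε * u.1) * u.2.1 / 2) -
    c₀' * v.2.1 - c₁' * (v.2.2 + (1 + ε * v.1) * v.2.1 / 2)

lemma midpoint_le_midpointGap {D : ℝ × ℝ × ℝ → ℝ × ℝ × ℝ → ℝ} {η ε : ℝ} (hε : 0 < ε)
    {u v m : ℝ × ℝ × ℝ} (c₀ c₁ c₀' c₁' : ℝ)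
    (hup : D ((-1, 0, 0) + ε • u) ((1, 0, 0) + ε • v) ≤
      2 + ε * (v.1 - u.1) + (1 + η) / 2 * (ε ^ 2 * energyBound ε u v))
    (hlow : calib η (ε * c₀) (ε * c₁) (ε • m) - calib η (ε * c₀) (ε * c₁) ((-1, 0, 0) + ε • u) ≤
      D ((-1, 0, 0) + ε • u) (ε • m))
    (hlow' : calib η (ε * c₀') (ε * c₁') ((1, 0, 0) + ε • v) - calib η (ε * c₀') (ε * c₁') (ε • m) ≤
      D (ε • m) ((1, 0, 0) + ε • v))
    (hD : D ((-1, 0, 0) + ε • u) (ε • m) + D (ε • m) ((1, 0, 0) + ε • v) ≤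
      D ((-1, 0, 0) + ε • u) ((1, 0, 0) + ε • v)) :
    (c₀ - c₀') * m.2.1 + (c₁ - c₁') * (m.2.2 + ε * m.1 * m.2.1 / 2) ≤
      midpointGap c₀ c₁ c₀' c₁' ε η u v m.1 := by
  have h := ((add_le_add hlow hlow').trans hD).trans hup
  refine le_of_mul_le_mul_left (a := ε ^ 2) ?_ (by positivity)
  rw [← sub_nonneg] at h ⊢
  refine h.trans_eq ?_
  simp only [calib, midpointGap, primitiveSq, Prod.smul_fst, Prod.smul_snd, Prod.fst_add,
    Prod.snd_add, smul_eq_mul]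
  ring

def midBox : Set (ℝ × ℝ × ℝ) := Icc (-1, -100, -1) (1, 100, 1)

lemma eventually_midpointGap_lt {c₀ c₁ c₀' c₁' : ℝ × ℝ × ℝ → ℝ × ℝ × ℝ → ℝ}
    (h₀ : Continuous fun p : (ℝ × ℝ × ℝ) × (ℝ × ℝ × ℝ) => c₀ p.1 p.2)
    (h₁ : Continuous fun p : (ℝ × ℝ × ℝ) × (ℝ × ℝ × ℝ) => c₁ p.1 p.2)
    (h₀' : Continuous fun p : (ℝ × ℝ × ℝ) × (ℝ × ℝ × ℝ) => c₀' p.1 p.2)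
    (h₁' : Continuous fun p : (ℝ × ℝ × ℝ) × (ℝ × ℝ × ℝ) => c₁' p.1 p.2) {k : ℝ}
    (hk : ∀ u ∈ midBox, ∀ v ∈ midBox, ∀ x,
      midpointGap (c₀ u v) (c₁ u v) (c₀' u v) (c₁' u v) 0 0 u v x < k) :
    ∀ᶠ s : ℝ × ℝ in 𝓝 (0, 0), ∀ u ∈ midBox, ∀ v ∈ midBox, ∀ x ∈ Icc (-2 : ℝ) 2,
      midpointGap (c₀ u v) (c₁ u v) (c₀' u v) (c₁' u v) s.1 s.2 u v x < k := by
  have hK : IsCompact ((midBox ×ˢ midBox) ×ˢ Icc (-2 : ℝ) 2) :=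
    (isCompact_Icc.prod isCompact_Icc).prod isCompact_Icc
  have := hK.eventually_forall_of_forall_eventually (x₀ := ((0, 0) : ℝ × ℝ))
    (P := fun s p => midpointGap (c₀ p.1.1 p.1.2) (c₁ p.1.1 p.1.2) (c₀' p.1.1 p.1.2)
      (c₁' p.1.1 p.1.2) s.1 s.2 p.1.1 p.1.2 p.2 < k) ?_
  · filter_upwards [this] with s hs u hu v hv x hx
    exact hs ((u, v), x) ⟨⟨hu, hv⟩, hx⟩
  · rintro ⟨⟨u, v⟩, x⟩ ⟨⟨hu, hv⟩, hx⟩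
    refine ContinuousAt.eventually_lt ?_ continuousAt_const (hk u hu v hv x)
    have e₀ : Continuous fun z : (ℝ × ℝ) × (((ℝ × ℝ × ℝ) × (ℝ × ℝ × ℝ)) × ℝ) =>
      c₀ z.2.1.1 z.2.1.2 := h₀.comp (by fun_prop : Continuous fun z : (ℝ × ℝ) ×
        (((ℝ × ℝ × ℝ) × (ℝ × ℝ × ℝ)) × ℝ) => z.2.1)
    have e₁ : Continuous fun z : (ℝ × ℝ) × (((ℝ × ℝ × ℝ) × (ℝ × ℝ × ℝ)) × ℝ) =>
      c₁ z.2.1.1 z.2.1.2 := h₁.comp (by fun_prop : Continuous fun z : (ℝ × ℝ) ×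
        (((ℝ × ℝ × ℝ) × (ℝ × ℝ × ℝ)) × ℝ) => z.2.1)
    have e₀' : Continuous fun z : (ℝ × ℝ) × (((ℝ × ℝ × ℝ) × (ℝ × ℝ × ℝ)) × ℝ) =>
      c₀' z.2.1.1 z.2.1.2 := h₀'.comp (by fun_prop : Continuous fun z : (ℝ × ℝ) ×
        (((ℝ × ℝ × ℝ) × (ℝ × ℝ × ℝ)) × ℝ) => z.2.1)
    have e₁' : Continuous fun z : (ℝ × ℝ) × (((ℝ × ℝ × ℝ) × (ℝ × ℝ × ℝ)) × ℝ) =>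
      c₁' z.2.1.1 z.2.1.2 := h₁'.comp (by fun_prop : Continuous fun z : (ℝ × ℝ) ×
        (((ℝ × ℝ × ℝ) × (ℝ × ℝ × ℝ)) × ℝ) => z.2.1)
    have hE : ContinuousAt (fun z : (ℝ × ℝ) × (((ℝ × ℝ × ℝ) × (ℝ × ℝ × ℝ)) × ℝ) =>
        energyBound z.1.1 z.2.1.1 z.2.1.2) ((0, 0), ((u, v), x)) := by
      unfold energyBound
      fun_prop (disch := simp)
    unfold midpointGap primitiveSq
    fun_prop

noncomputable def baseSlope (u v : ℝ × ℝ × ℝ) : ℝ := (v.2.1 - u.2.1) / 2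

noncomputable def baseTwist (u v : ℝ × ℝ × ℝ) : ℝ :=
  3 * (v.2.2 - u.2.2 + (u.2.1 + v.2.1) / 2) / 2

lemma midpointGap_slope_zero (δ : ℝ) (u v : ℝ × ℝ × ℝ) (x : ℝ) :
    midpointGap (baseSlope u v + 4 * δ) (baseTwist u v + 6 * δ) (baseSlope u v - 4 * δ)
      (baseTwist u v + 6 * δ) 0 0 u v x =
    8 * δ * ((u.2.1 + v.2.1) / 8 + 3 / 4 * (u.2.2 - v.2.2)) + 4 * δ ^ 2 := by
  simp only [midpointGap, energyBound, primitiveSq, baseSlope, baseTwist]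
  ring

lemma midpointGap_twist_zero (δ : ℝ) (u v : ℝ × ℝ × ℝ) (x : ℝ) :
    midpointGap (baseSlope u v + 6 * δ) (baseTwist u v + 12 * δ) (baseSlope u v + 6 * δ)
      (baseTwist u v - 12 * δ) 0 0 u v x =
    24 * δ * ((u.2.2 + v.2.2) / 2) + 12 * δ ^ 2 := by
  simp only [midpointGap, energyBound, primitiveSq, baseSlope, baseTwist]
  ring

lemma exists_midpointGap_bounds : ∃ η > (0 : ℝ), η ≤ 1 ∧ ∃ ε₁ > (0 : ℝ), ∀ ε, 0 < ε → ε ≤ ε₁ →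
    ∀ u ∈ midBox, ∀ v ∈ midBox, ∀ x ∈ Icc (-2 : ℝ) 2, ∀ δ : ℝ, δ = 1 / 4 ∨ δ = -1 / 4 →
      midpointGap (baseSlope u v + 4 * δ) (baseTwist u v + 6 * δ) (baseSlope u v - 4 * δ)
        (baseTwist u v + 6 * δ) ε η u v x ≤ 107 / 2 ∧
      midpointGap (baseSlope u v + 6 * δ) (baseTwist u v + 12 * δ) (baseSlope u v + 6 * δ)
        (baseTwist u v - 12 * δ) ε η u v x ≤ 7 := by
  have cs : Continuous fun p : (ℝ × ℝ × ℝ) × (ℝ × ℝ × ℝ) => baseSlope p.1 p.2 := by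
    unfold baseSlope; fun_prop
  have ct : Continuous fun p : (ℝ × ℝ × ℝ) × (ℝ × ℝ × ℝ) => baseTwist p.1 p.2 := by
    unfold baseTwist; fun_prop
  have slope : ∀ δ : ℝ, δ = 1 / 4 ∨ δ = -1 / 4 → ∀ᶠ s : ℝ × ℝ in 𝓝 (0, 0),
      ∀ u ∈ midBox, ∀ v ∈ midBox, ∀ x ∈ Icc (-2 : ℝ) 2,
      midpointGap (baseSlope u v + 4 * δ) (baseTwist u v + 6 * δ) (baseSlope u v - 4 * δ)
        (baseTwist u v + 6 * δ) s.1 s.2 u v x < 107 / 2 := fun δ hδ => by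
    refine eventually_midpointGap_lt (c₀ := fun u v => baseSlope u v + 4 * δ)
      (c₁ := fun u v => baseTwist u v + 6 * δ) (c₀' := fun u v => baseSlope u v - 4 * δ)
      (c₁' := fun u v => baseTwist u v + 6 * δ) (by fun_prop) (by fun_prop) (by fun_prop)
      (by fun_prop) ?_
    rintro u ⟨⟨hu1, hu2, hu3⟩, hu4, hu5, hu6⟩ v ⟨⟨hv1, hv2, hv3⟩, hv4, hv5, hv6⟩ x
    simp only at *
    rw [midpointGap_slope_zero]
    rcases hδ with rfl | rfl <;> linarith
  have twist : ∀ δ : ℝ, δ = 1 / 4 ∨ δ = -1 / 4 → ∀ᶠ s : ℝ × ℝ in 𝓝 (0, 0),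
      ∀ u ∈ midBox, ∀ v ∈ midBox, ∀ x ∈ Icc (-2 : ℝ) 2,
      midpointGap (baseSlope u v + 6 * δ) (baseTwist u v + 12 * δ) (baseSlope u v + 6 * δ)
        (baseTwist u v - 12 * δ) s.1 s.2 u v x < 7 := fun δ hδ => by
    refine eventually_midpointGap_lt (c₀ := fun u v => baseSlope u v + 6 * δ)
      (c₁ := fun u v => baseTwist u v + 12 * δ) (c₀' := fun u v => baseSlope u v + 6 * δ)
      (c₁' := fun u v => baseTwist u v - 12 * δ) (by fun_prop) (by fun_prop) (by fun_prop)
      (by fun_prop) ?_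
    rintro u ⟨⟨hu1, hu2, hu3⟩, hu4, hu5, hu6⟩ v ⟨⟨hv1, hv2, hv3⟩, hv4, hv5, hv6⟩ x
    simp only at *
    rw [midpointGap_twist_zero]
    rcases hδ with rfl | rfl <;> linarith
  have all := ((slope _ (.inl rfl)).and (slope _ (.inr rfl))).and
    ((twist _ (.inl rfl)).and (twist _ (.inr rfl)))
  obtain ⟨ρ, hρ, hball⟩ := Metric.eventually_nhds_iff.1 all
  refine ⟨min 1 (ρ / 2), by positivity, min_le_left _ _, ρ / 2, by positivity, ?_⟩
  intro ε hε hερ u hu v hv x hx δ hδ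
  have hd : dist ((ε, min 1 (ρ / 2)) : ℝ × ℝ) (0, 0) < ρ := by
    rw [Prod.dist_eq, max_lt_iff, Real.dist_0_eq_abs, Real.dist_0_eq_abs, abs_of_pos hε,
      abs_of_pos (by positivity)]
    have := min_le_right 1 (ρ / 2)
    constructor <;> linarith
  obtain ⟨⟨h1, h2⟩, h3, h4⟩ := hball hd
  rcases hδ with rfl | rfl
  · exact ⟨(h1 u hu v hv x hx).le, (h3 u hu v hv x hx).le⟩
  · exact ⟨(h2 u hu v hv x hx).le, (h4 u hu v hv x hx).le⟩

lemma energyBound_nonneg_le {ε : ℝ} (hε : 0 < ε) (hε1 : ε ≤ 1 / 1000000) {u v : ℝ × ℝ × ℝ}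
    (hu : u ∈ midBox) (hv : v ∈ midBox) : energyBound ε u v ≤ 170000 ∧
      |v.2.2 - u.2.2 + (u.2.1 + v.2.1) / 2 + ε * (u.2.1 * v.1 - u.1 * v.2.1) / 2| ≤ 103 := by
  obtain ⟨⟨hu1, hu2, hu3⟩, hu4, hu5, hu6⟩ := hu
  obtain ⟨⟨hv1, hv2, hv3⟩, hv4, hv5, hv6⟩ := hv
  simp only at *
  have hX : 1 ≤ 2 + ε * (v.1 - u.1) := by nlinarith
  have hX3 : 1 ≤ (2 + ε * (v.1 - u.1)) ^ 3 := one_le_pow₀ hX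
  have a1 : |u.2.1 * v.1| ≤ 100 := by
    rw [abs_mul]
    have h1 : |u.2.1| ≤ 100 := abs_le.2 ⟨hu2, hu5⟩
    have h2 : |v.1| ≤ 1 := abs_le.2 ⟨hv1, hv4⟩
    nlinarith [abs_nonneg u.2.1, abs_nonneg v.1]
  have a2 : |u.1 * v.2.1| ≤ 100 := by
    rw [abs_mul]
    have h1 : |v.2.1| ≤ 100 := abs_le.2 ⟨hv2, hv5⟩
    have h2 : |u.1| ≤ 1 := abs_le.2 ⟨hu1, hu4⟩
    nlinarith [abs_nonneg v.2.1, abs_nonneg u.1]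
  rw [abs_le] at a1 a2
  have a3 : ε * (u.2.1 * v.1 - u.1 * v.2.1) ≤ 1 := by nlinarith
  have a4 : -1 ≤ ε * (u.2.1 * v.1 - u.1 * v.2.1) := by nlinarith
  have a5 : |v.2.2 - u.2.2 + (u.2.1 + v.2.1) / 2 + ε * (u.2.1 * v.1 - u.1 * v.2.1) / 2| ≤ 103 := by
    rw [abs_le]
    constructor <;> linarith
  refine ⟨?_, a5⟩
  have b1 : (v.2.1 - u.2.1) ^ 2 ≤ 200 ^ 2 := sq_le_sq' (by linarith) (by linarith)
  have b2 := sq_le_sq.2 (a5.trans_eq (abs_of_pos (by norm_num : (0 : ℝ) < 103)).symm)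
  have c1 := div_le_self (sq_nonneg (v.2.1 - u.2.1)) hX
  have c2 := div_le_self (a := 12 * (v.2.2 - u.2.2 + (u.2.1 + v.2.1) / 2 +
    ε * (u.2.1 * v.1 - u.1 * v.2.1) / 2) ^ 2) (by positivity) hX3
  unfold energyBound
  linarith

def smallBox : Set (ℝ × ℝ × ℝ) := Icc (-(5 / 4), -(107 / 4), -(5 / 4)) (5 / 4, 107 / 4, 5 / 4)

set_option maxHeartbeats 600000 in
lemma exists_midpoint_mem_smallBox : ∃ η > (0 : ℝ), ∀ s₀ > (0 : ℝ), ∀ β₀ > (0 : ℝ),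
    ∃ ε > (0 : ℝ), ε ≤ 1 / 1000000 ∧ ∀ D : ℝ × ℝ × ℝ → ℝ × ℝ × ℝ → ℝ,
      (∀ p q : ℝ × ℝ × ℝ, ∀ X Y Z : ℝ, q.1 - p.1 = X → q.2.1 - p.2.1 = Y →
        q.2.2 - p.2.2 - (p.1 * q.2.1 - p.2.1 * q.1) / 2 = Z → 0 < X →
        |Y| + |6 * Z / X| ≤ s₀ * X → D p q ≤ X + (1 + η) / 2 * (Y ^ 2 / X + 12 * Z ^ 2 / X ^ 3)) →
      (∀ (p q : ℝ × ℝ × ℝ) (c₀ c₁ : ℝ), D p q < 5 → |c₀| + |c₁| * (|p.1| + 5) ≤ β₀ →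
        calib η c₀ c₁ q - calib η c₀ c₁ p ≤ D p q) →
      ∀ u ∈ midBox, ∀ v ∈ midBox, D ((-1, 0, 0) + ε • u) ((1, 0, 0) + ε • v) ≤ 3 ∧
        ∀ m, D ((-1, 0, 0) + ε • u) m = D ((-1, 0, 0) + ε • u) ((1, 0, 0) + ε • v) / 2 →
          D m ((1, 0, 0) + ε • v) = D ((-1, 0, 0) + ε • u) ((1, 0, 0) + ε • v) / 2 →
          m ∈ (fun p => ε • p) '' smallBox := by
  obtain ⟨η, hη, hη1, ε₁, hε₁, hgap⟩ := exists_midpointGap_bounds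
  refine ⟨η, hη, fun s₀ hs₀ β₀ hβ₀ => ?_⟩
  obtain ⟨ε, hε, hεle⟩ : ∃ ε > (0 : ℝ), ε ≤ min (min ε₁ (1 / 1000000)) (min (s₀ / 1000) (β₀ / 1200)) :=
    ⟨_, by positivity, le_rfl⟩
  simp only [le_min_iff] at hεle
  obtain ⟨⟨hεε, hε1⟩, hεs, hεβ⟩ := hεle
  refine ⟨ε, hε, hε1, fun D hU hL u hu v hv => ?_⟩
  have hgap := hgap ε hε hεε u hu v hv
  obtain ⟨hE, hZ⟩ := energyBound_nonneg_le hε hε1 hu hv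
  obtain ⟨⟨hu1, hu2, hu3⟩, hu4, hu5, hu6⟩ := hu
  obtain ⟨⟨hv1, hv2, hv3⟩, hv4, hv5, hv6⟩ := hv
  simp only at hu1 hu2 hu3 hu4 hu5 hu6 hv1 hv2 hv3 hv4 hv5 hv6
  set a : ℝ × ℝ × ℝ := (-1, 0, 0) + ε • u with ha
  set b : ℝ × ℝ × ℝ := (1, 0, 0) + ε • v with hb
  set W := v.2.2 - u.2.2 + (u.2.1 + v.2.1) / 2 + ε * (u.2.1 * v.1 - u.1 * v.2.1) / 2 with hW
  have eu1 : ε * u.1 ≤ ε * 1 := mul_le_mul_of_nonneg_left hu4 hε.le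
  have eu2 : ε * -1 ≤ ε * u.1 := mul_le_mul_of_nonneg_left hu1 hε.le
  have ev1 : ε * v.1 ≤ ε * 1 := mul_le_mul_of_nonneg_left hv4 hε.le
  have ev2 : ε * -1 ≤ ε * v.1 := mul_le_mul_of_nonneg_left hv1 hε.le
  have hX : 1 ≤ 2 + ε * (v.1 - u.1) := by linarith
  have ha1 : a.1 = -1 + ε * u.1 := rfl
  have hb1 : b.1 = 1 + ε * v.1 := rfl
  have hup : D a b ≤ 2 + ε * (v.1 - u.1) + (1 + η) / 2 * (ε ^ 2 * energyBound ε u v) := by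
    have := hU a b (2 + ε * (v.1 - u.1)) (ε * (v.2.1 - u.2.1)) (ε * W)
      (by rw [ha1, hb1]; ring) (by simp [ha, hb]; ring)
      (by simp [ha, hb, hW]; ring) (by linarith) ?_
    · refine this.trans_eq ?_
      rw [energyBound, ← hW]
      ring
    · rw [abs_mul, abs_of_pos hε, abs_div, abs_of_pos (a := 2 + ε * (v.1 - u.1)) (by linarith)]
      have h1 := div_le_self (abs_nonneg (6 * (ε * W))) hX
      have h2 : |6 * (ε * W)| = 6 * (ε * |W|) := by
        rw [abs_mul, abs_mul, abs_of_pos hε, abs_of_pos (by norm_num : (0 : ℝ) < 6)]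
      have h3 : |v.2.1 - u.2.1| ≤ 200 := abs_le.2 ⟨by linarith, by linarith⟩
      have h4 := mul_le_mul_of_nonneg_left hZ hε.le
      have h5 := mul_le_mul_of_nonneg_left h3 hε.le
      have h6 := mul_le_mul_of_nonneg_left hX hs₀.le
      linarith
  have hsq : (1 + η) / 2 * (ε ^ 2 * energyBound ε u v) ≤ ε * (17 / 100) := by
    have h1 : ε ^ 2 * energyBound ε u v ≤ ε ^ 2 * 170000 := by gcongr
    have h2 : ε ^ 2 * 170000 ≤ ε * (17 / 100) := by
      have := mul_le_mul_of_nonneg_left hε1 hε.le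
      linarith
    have h3 := mul_le_mul_of_nonneg_left (h1.trans h2) (by linarith : 0 ≤ (1 + η) / 2)
    have h4 := mul_le_mul_of_nonneg_right (by linarith : (1 + η) / 2 ≤ 1)
      (by positivity : 0 ≤ ε * (17 / 100))
    linarith
  have hD3 : D a b ≤ 3 := by linarith
  refine ⟨hD3, fun m hm1 hm2 => ?_⟩
  obtain ⟨m, rfl⟩ : ∃ m', m = ε • m' := ⟨ε⁻¹ • m, by rw [smul_inv_smul₀ hε.ne']⟩
  have hlow0 := hL a (ε • m) 0 0 (by linarith) (by simpa using hβ₀.le)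
  have hlow0' := hL (ε • m) b 0 0 (by linarith) (by simpa using hβ₀.le)
  simp only [calib, Prod.smul_fst, smul_eq_mul, ha1, hb1] at hlow0 hlow0'
  have hx1 : m.1 ≤ 5 / 4 := by
    refine le_of_mul_le_mul_left (a := ε) ?_ hε
    linarith
  have hx2 : -(5 / 4) ≤ m.1 := by
    refine le_of_mul_le_mul_left (a := ε) ?_ hε
    linarith
  have hgap := hgap m.1 ⟨by linarith, by linarith⟩
  have hbs : |baseSlope u v| ≤ 100 := by
    rw [baseSlope, abs_le]; constructor <;> linarith
  have hbt : |baseTwist u v| ≤ 153 := by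
    rw [baseTwist, abs_le]; constructor <;> linarith
  rw [abs_le] at hbs hbt
  have hcoef : ∀ c₀ c₁ s, |c₀| ≤ 102 → |c₁| ≤ 156 → |s| ≤ 2 →
      |ε * c₀| + |ε * c₁| * (|s| + 5) ≤ β₀ := fun c₀ c₁ s h0 h1 h2 => by
    rw [abs_mul, abs_mul, abs_of_pos hε]
    have : |c₁| * (|s| + 5) ≤ 156 * (2 + 5) := by gcongr
    have : ε * (|c₀| + |c₁| * (|s| + 5)) ≤ ε * 1200 := by gcongr; linarith
    linarith
  have hsa : |a.1| ≤ 2 := by rw [ha1, abs_le]; constructor <;> linarith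
  have hsm : |(ε • m).1| ≤ 2 := by
    have h1 := mul_le_mul_of_nonneg_left hx1 hε.le
    have h2 := mul_le_mul_of_nonneg_left hx2 hε.le
    rw [Prod.smul_fst, smul_eq_mul, abs_le]; constructor <;> linarith
  have key : ∀ c₀ c₁ c₀' c₁', |c₀| ≤ 102 → |c₁| ≤ 156 → |c₀'| ≤ 102 → |c₁'| ≤ 156 →
      (c₀ - c₀') * m.2.1 + (c₁ - c₁') * (m.2.2 + ε * m.1 * m.2.1 / 2) ≤
        midpointGap c₀ c₁ c₀' c₁' ε η u v m.1 := fun c₀ c₁ c₀' c₁' h0 h1 h0' h1' =>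
    midpoint_le_midpointGap hε c₀ c₁ c₀' c₁' hup
      (hL _ _ _ _ (by linarith) (hcoef _ _ _ h0 h1 hsa))
      (hL _ _ _ _ (by linarith) (hcoef _ _ _ h0' h1' hsm)) (by linarith)
  have hslope : ∀ δ : ℝ, δ = 1 / 4 ∨ δ = -1 / 4 → 8 * δ * m.2.1 ≤ 107 / 2 := fun δ hδ => by
    have h1 := (hgap δ hδ).1
    have hδ1 : |δ| ≤ 1 / 4 := by rcases hδ with rfl | rfl <;> norm_num [abs_le]
    rw [abs_le] at hδ1
    have h2 := key (baseSlope u v + 4 * δ) (baseTwist u v + 6 * δ) (baseSlope u v - 4 * δ)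
      (baseTwist u v + 6 * δ) (abs_le.2 ⟨by linarith, by linarith⟩)
      (abs_le.2 ⟨by linarith, by linarith⟩) (abs_le.2 ⟨by linarith, by linarith⟩)
      (abs_le.2 ⟨by linarith, by linarith⟩)
    linarith
  have htwist : ∀ δ : ℝ, δ = 1 / 4 ∨ δ = -1 / 4 →
      24 * δ * (m.2.2 + ε * m.1 * m.2.1 / 2) ≤ 7 := fun δ hδ => by
    have h1 := (hgap δ hδ).2
    have hδ1 : |δ| ≤ 1 / 4 := by rcases hδ with rfl | rfl <;> norm_num [abs_le]
    rw [abs_le] at hδ1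
    have h2 := key (baseSlope u v + 6 * δ) (baseTwist u v + 12 * δ) (baseSlope u v + 6 * δ)
      (baseTwist u v - 12 * δ) (abs_le.2 ⟨by linarith, by linarith⟩)
      (abs_le.2 ⟨by linarith, by linarith⟩) (abs_le.2 ⟨by linarith, by linarith⟩)
      (abs_le.2 ⟨by linarith, by linarith⟩)
    linarith
  have s1 := hslope _ (.inl rfl)
  have s2 := hslope _ (.inr rfl)
  have t1 := htwist _ (.inl rfl)
  have t2 := htwist _ (.inr rfl)
  have hprod : |m.1 * m.2.1| ≤ 100 := by
    rw [abs_mul]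
    have h1 : |m.1| ≤ 5 / 4 := abs_le.2 ⟨hx2, hx1⟩
    have h2 : |m.2.1| ≤ 107 / 4 := abs_le.2 ⟨by linarith, by linarith⟩
    exact (mul_le_mul h1 h2 (abs_nonneg _) (by norm_num)).trans (by norm_num)
  rw [abs_le] at hprod
  have p1 : ε * (m.1 * m.2.1) ≤ 1 / 10000 :=
    (mul_le_mul_of_nonneg_left hprod.2 hε.le).trans (by linarith)
  have p2 : -(1 / 10000) ≤ ε * (m.1 * m.2.1) :=
    le_trans (by linarith) (mul_le_mul_of_nonneg_left hprod.1 hε.le)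
  refine mem_image_of_mem _ ⟨⟨hx2, ?_, ?_⟩, hx1, ?_, ?_⟩ <;> simp only <;> linarith

lemma le_sigmaCoeff_half {K N θ : ℝ} (hN : 0 < N) (hθ : 0 ≤ θ) :
    ENNReal.ofReal (1 / (2 * Real.cosh (1 / 2 * θ * Real.sqrt (-K / N)))) ≤
      sigmaCoeff K N (1 / 2) θ := by
  have hle : 1 / (2 * Real.cosh (1 / 2 * θ * Real.sqrt (-K / N))) ≤ 1 / 2 := by
    refine one_div_le_one_div_of_le two_pos ?_
    linarith [Real.one_le_cosh (1 / 2 * θ * Real.sqrt (-K / N))]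
  unfold sigmaCoeff
  split_ifs with h0 h1 h2
  · exact ENNReal.ofReal_le_ofReal hle
  · refine ENNReal.ofReal_le_ofReal (le_of_eq ?_)
    have hθ0 : 0 < θ := hθ.lt_of_ne fun h => h0 (by rw [← h]; ring)
    have hs : 0 < Real.sqrt (-K / N) := Real.sqrt_pos.2 (div_pos (by linarith) hN)
    have hpos : 0 < Real.sinh (1 / 2 * θ * Real.sqrt (-K / N)) := Real.sinh_pos_iff.2 (by positivity)
    have hc := Real.cosh_pos (1 / 2 * θ * Real.sqrt (-K / N))
    rw [show θ * Real.sqrt (-K / N) = 2 * (1 / 2 * θ * Real.sqrt (-K / N)) by ring,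
      Real.sinh_two_mul]
    generalize 1 / 2 * θ * Real.sqrt (-K / N) = w at hpos hc ⊢
    field_simp
  · refine (ENNReal.ofReal_le_ofReal hle).trans (ENNReal.ofReal_le_ofReal ?_)
    have hθ0 : 0 < θ := hθ.lt_of_ne fun h => h0 (by rw [← h]; ring)
    have hK : 0 < K := (not_lt.1 h1).lt_of_ne fun h => h0 (by rw [← h]; ring)
    have hs : 0 < Real.sqrt (K / N) := Real.sqrt_pos.2 (div_pos hK hN)
    have hlt : θ * Real.sqrt (K / N) < Real.pi := by
      refine lt_of_pow_lt_pow_left₀ 2 Real.pi_pos.le ?_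
      rw [mul_pow, Real.sq_sqrt (by positivity), ← mul_div_assoc, div_lt_iff₀ hN]
      linarith
    have hsin : 0 < Real.sin (1 / 2 * θ * Real.sqrt (K / N)) :=
      Real.sin_pos_of_pos_of_lt_pi (by positivity) (by nlinarith [mul_pos hθ0 hs])
    have hcos : 0 < Real.cos (1 / 2 * θ * Real.sqrt (K / N)) :=
      Real.cos_pos_of_mem_Ioo ⟨by nlinarith [mul_pos hθ0 hs, Real.pi_pos], by linarith⟩
    rw [show θ * Real.sqrt (K / N) = 2 * (1 / 2 * θ * Real.sqrt (K / N)) by ring,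
      Real.sin_two_mul]
    generalize 1 / 2 * θ * Real.sqrt (K / N) = w at hsin hcos ⊢
    rw [le_div_iff₀ (by positivity)]
    nlinarith [Real.cos_le_one w]
  · exact le_top

lemma exists_lt_tauCoeff_half (K : ℝ) {N : ℝ} (hN : 1 < N) : ∃ θ₀ > (0 : ℝ), ∀ θ, 0 ≤ θ → θ ≤ θ₀ →
    ENNReal.ofReal (1 / 2) ^ (1 / N) * ENNReal.ofReal (1 / 2) < tauCoeff K N (1 / 2) θ := by
  have hexp : 0 < 1 - 1 / N := by
    rw [sub_pos, div_lt_one (by linarith)]; exact hN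
  have hN0 : 0 < 1 / N := by positivity
  have hc : ContinuousAt (fun θ : ℝ =>
      (1 / (2 * Real.cosh (1 / 2 * θ * Real.sqrt (-K / (N - 1))))) ^ (1 - 1 / N)) 0 := by
    refine ContinuousAt.rpow_const ?_ (.inr hexp.le)
    refine continuousAt_const.div (by fun_prop) (by simp)
  have hlt : (1 / 2 : ℝ) < (1 / (2 * Real.cosh (1 / 2 * 0 * Real.sqrt (-K / (N - 1))))) ^ (1 - 1 / N) := by
    rw [mul_zero, zero_mul, Real.cosh_zero, mul_one]
    conv_lhs => rw [← Real.rpow_one (1 / 2)]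
    exact Real.rpow_lt_rpow_of_exponent_gt (by norm_num) (by norm_num) (by linarith)
  obtain ⟨ρ, hρ, hball⟩ := Metric.eventually_nhds_iff.1 (hc.eventually (lt_mem_nhds hlt))
  refine ⟨ρ / 2, by positivity, fun θ h0 h1 => ?_⟩
  have h2 := hball (y := θ) (by rw [Real.dist_0_eq_abs, abs_of_nonneg h0]; linarith)
  have hpos := Real.cosh_pos (1 / 2 * θ * Real.sqrt (-K / (N - 1)))
  unfold tauCoeff
  refine (ENNReal.mul_lt_mul_iff_right ?_ ?_).2 ?_
  · exact (ENNReal.rpow_pos (by simp) (by simp)).ne'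
  · exact ENNReal.rpow_ne_top_of_nonneg hN0.le (by simp)
  · refine lt_of_lt_of_le ?_ (ENNReal.rpow_le_rpow (le_sigmaCoeff_half (by linarith) h0) hexp.le)
    rw [ENNReal.ofReal_rpow_of_nonneg (by positivity) hexp.le]
    exact (ENNReal.ofReal_lt_ofReal_iff_of_nonneg (by norm_num)).2 h2

lemma rpow_lt_of_le_half {N : ℝ} (hN : 1 < N) {τ μ mA mB mM : ENNReal} (hμ : μ ≠ 0) (hμ' : μ ≠ ⊤)
    (hA : μ ≤ mA) (hB : μ ≤ mB) (hM : mM ≤ ENNReal.ofReal (1 / 2) * μ)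
    (hτ : ENNReal.ofReal (1 / 2) ^ (1 / N) * ENNReal.ofReal (1 / 2) < τ) :
    mM ^ (1 / N) < τ * mA ^ (1 / N) + τ * mB ^ (1 / N) := by
  have hN0 : 0 < 1 / N := by positivity
  set c := ENNReal.ofReal (1 / 2) ^ (1 / N) with hc
  have hhalf : ENNReal.ofReal (1 / 2) + ENNReal.ofReal (1 / 2) = 1 := by
    rw [← ENNReal.ofReal_add (by norm_num) (by norm_num)]; norm_num
  have hμN : μ ^ (1 / N) ≠ 0 := (ENNReal.rpow_pos (pos_iff_ne_zero.2 hμ) hμ').ne'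
  have hμN' : μ ^ (1 / N) ≠ ⊤ := ENNReal.rpow_ne_top_of_nonneg hN0.le hμ'
  calc mM ^ (1 / N) ≤ (ENNReal.ofReal (1 / 2) * μ) ^ (1 / N) := ENNReal.rpow_le_rpow hM hN0.le
    _ = c * μ ^ (1 / N) := ENNReal.mul_rpow_of_nonneg _ _ hN0.le
    _ = c * ENNReal.ofReal (1 / 2) * μ ^ (1 / N) + c * ENNReal.ofReal (1 / 2) * μ ^ (1 / N) := by
      rw [← add_mul, ← mul_add, hhalf, mul_one]
    _ < τ * μ ^ (1 / N) + τ * μ ^ (1 / N) :=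
      ENNReal.add_lt_add ((ENNReal.mul_lt_mul_iff_left hμN hμN').2 hτ)
        ((ENNReal.mul_lt_mul_iff_left hμN hμN').2 hτ)
    _ ≤ _ := by gcongr

lemma exists_norm_heisEquiv_smul_lt (e f : ℝ × ℝ) (R : ℝ) {ρ : ℝ} (hρ : 0 < ρ) :
    ∃ r₀ > (0 : ℝ), ∀ r, 0 < r → r ≤ r₀ → ∀ hd, ∀ p ∈ Metric.closedBall (0 : ℝ × ℝ × ℝ) R,
      ‖heisEquiv (r • e) (r • f) hd p‖ < ρ := by
  have h := (isCompact_closedBall (0 : ℝ × ℝ × ℝ) R).eventually_forall_of_forall_eventually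
    (x₀ := (0 : ℝ)) (P := fun r p => ‖(p.1 * (r * e.1) + p.2.1 * (r * f.1),
      p.1 * (r * e.2) + p.2.1 * (r * f.2),
      ((r * e.1) * (r * f.2) - (r * e.2) * (r * f.1)) * p.2.2)‖ < ρ) fun p _ => by
    refine ContinuousAt.eventually_lt (by fun_prop) continuousAt_const ?_
    simpa using hρ
  obtain ⟨s, hs, hball⟩ := Metric.eventually_nhds_iff.1 h
  refine ⟨s / 2, by positivity, fun r hr hrs hd p hp => ?_⟩
  exact hball (y := r) (by rw [Real.dist_0_eq_abs, abs_of_pos hr]; linarith) p hp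

lemma volume_Icc_prod {a₁ a₂ a₃ b₁ b₂ b₃ : ℝ} (h₁ : a₁ ≤ b₁) (h₂ : a₂ ≤ b₂) :
    volume (Icc (a₁, a₂, a₃) (b₁, b₂, b₃)) =
      ENNReal.ofReal ((b₁ - a₁) * ((b₂ - a₂) * (b₃ - a₃))) := by
  rw [Icc_prod_eq, Icc_prod_eq, Measure.volume_eq_prod, Measure.prod_prod, Measure.volume_eq_prod,
    Measure.prod_prod]
  simp only [Real.volume_Icc]
  rw [← ENNReal.ofReal_mul (by linarith), ← ENNReal.ofReal_mul (by linarith)]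

lemma volume_linearEquiv_image_smul (Φ : (ℝ × ℝ × ℝ) ≃ₗ[ℝ] (ℝ × ℝ × ℝ)) {ε : ℝ} (hε : 0 < ε) :
    ∃ κ : ENNReal, κ ≠ 0 ∧ κ ≠ ⊤ ∧ ∀ (x : ℝ × ℝ × ℝ) (S : Set (ℝ × ℝ × ℝ)),
      volume (Φ '' ((fun p => x + ε • p) '' S)) = κ * volume S := by
  have : (volume : Measure (ℝ × ℝ)).IsAddHaarMeasure :=
    Measure.prod.instIsAddHaarMeasure volume volume
  have : (volume : Measure (ℝ × ℝ × ℝ)).IsAddHaarMeasure :=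
    Measure.prod.instIsAddHaarMeasure volume volume
  refine ⟨ENNReal.ofReal |LinearMap.det (Φ : (ℝ × ℝ × ℝ) →ₗ[ℝ] (ℝ × ℝ × ℝ))| *
    ENNReal.ofReal |ε ^ Module.finrank ℝ (ℝ × ℝ × ℝ)|, mul_ne_zero ?_ ?_,
    ENNReal.mul_ne_top ENNReal.ofReal_ne_top ENNReal.ofReal_ne_top, fun x S => ?_⟩
  · exact (ENNReal.ofReal_pos.2 (abs_pos.2 Φ.isUnit_det'.ne_zero)).ne'
  · exact (ENNReal.ofReal_pos.2 (by positivity)).ne'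
  · have h1 := Measure.addHaar_image_linearMap (volume : Measure (ℝ × ℝ × ℝ))
      (Φ : (ℝ × ℝ × ℝ) →ₗ[ℝ] (ℝ × ℝ × ℝ)) ((fun p => x + ε • p) '' S)
    rw [LinearEquiv.coe_coe] at h1
    rw [h1, mul_assoc, ← Measure.addHaar_smul, ← Set.image_smul,
      ← measure_preimage_add (volume : Measure (ℝ × ℝ × ℝ)) (-x)
        ((fun p => ε • p) '' S)]
    congr 2
    ext p
    simp only [mem_image, mem_preimage]
    constructor
    · rintro ⟨q, hq, rfl⟩
      exact ⟨q, hq, by abel⟩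
    · rintro ⟨q, hq, h⟩
      exact ⟨q, hq, by rw [h]; abel⟩

lemma heisEquiv_image_isCompact (Φ : (ℝ × ℝ × ℝ) ≃ₗ[ℝ] (ℝ × ℝ × ℝ)) (x : ℝ × ℝ × ℝ) (ε : ℝ)
    {S : Set (ℝ × ℝ × ℝ)} (hS : IsCompact S) : IsCompact (Φ '' ((fun p => x + ε • p) '' S)) := by
  refine (hS.image (by fun_prop)).image ?_
  exact LinearMap.continuous_of_finiteDimensional (Φ : (ℝ × ℝ × ℝ) →ₗ[ℝ] (ℝ × ℝ × ℝ))

lemma withDensity_ofReal_le {f : ℝ × ℝ × ℝ → ℝ} {S : Set (ℝ × ℝ × ℝ)} (hS : MeasurableSet S)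
    {c : ℝ} (h : ∀ p ∈ S, f p ≤ c) :
    (volume.withDensity fun p => ENNReal.ofReal (f p)) S ≤ ENNReal.ofReal c * volume S := by
  rw [withDensity_apply _ hS, ← setLIntegral_const]
  exact setLIntegral_mono' hS fun p hp => ENNReal.ofReal_le_ofReal (h p hp)

lemma le_withDensity_ofReal {f : ℝ × ℝ × ℝ → ℝ} {S : Set (ℝ × ℝ × ℝ)} (hS : MeasurableSet S)
    {c : ℝ} (h : ∀ p ∈ S, c ≤ f p) :
    ENNReal.ofReal c * volume S ≤ (volume.withDensity fun p => ENNReal.ofReal (f p)) S := by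
  rw [withDensity_apply _ hS, ← setLIntegral_const]
  exact setLIntegral_mono' hS fun p hp => ENNReal.ofReal_le_ofReal (h p hp)

lemma Theta_mem_Icc {X : Type*} {d : X → X → ℝ} {K R : ℝ} {A B : Set X} (hA : A.Nonempty)
    (hB : B.Nonempty) (h : ∀ a ∈ A, ∀ b ∈ B, 0 ≤ d a b ∧ d a b ≤ R) :
    0 ≤ Theta d K A B ∧ Theta d K A B ≤ R := by
  obtain ⟨a, ha⟩ := hA
  obtain ⟨b, hb⟩ := hB
  have hne : {r | ∃ a ∈ A, ∃ b ∈ B, r = d a b}.Nonempty := ⟨_, a, ha, b, hb, rfl⟩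
  have h0 : ∀ r ∈ {r | ∃ a ∈ A, ∃ b ∈ B, r = d a b}, 0 ≤ r := by
    rintro _ ⟨a, ha, b, hb, rfl⟩
    exact (h a ha b hb).1
  have h1 : ∀ r ∈ {r | ∃ a ∈ A, ∃ b ∈ B, r = d a b}, r ≤ R := by
    rintro _ ⟨a, ha, b, hb, rfl⟩
    exact (h a ha b hb).2
  unfold Theta
  split_ifs
  · exact ⟨Real.sInf_nonneg h0, (csInf_le ⟨0, h0⟩ ⟨a, ha, b, hb, rfl⟩).trans (h a ha b hb).2⟩
  · exact ⟨Real.sSup_nonneg h0, csSup_le hne h1⟩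

lemma norm_add_smul_le_three {x p : ℝ × ℝ × ℝ} {ε : ℝ} (hε : 0 < ε) (hε1 : ε ≤ 1 / 1000000)
    (hx : ‖x‖ ≤ 1) (hp : ‖p‖ ≤ 100) : x + ε • p ∈ Metric.closedBall (0 : ℝ × ℝ × ℝ) 3 := by
  rw [mem_closedBall_zero_iff]
  refine (norm_add_le _ _).trans ?_
  rw [norm_smul, Real.norm_eq_abs, abs_of_pos hε]
  nlinarith [norm_nonneg p]

lemma norm_le_of_mem_Icc_neg {a b : ℝ × ℝ × ℝ} {R : ℝ} (hb : b.1 ≤ R) (hb' : b.2.1 ≤ R)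
    (hb'' : b.2.2 ≤ R) (ha : -R ≤ a.1) (ha' : -R ≤ a.2.1) (ha'' : -R ≤ a.2.2)
    {p : ℝ × ℝ × ℝ} (hp : p ∈ Icc a b) : ‖p‖ ≤ R := by
  obtain ⟨⟨h1, h2, h3⟩, h4, h5, h6⟩ := hp
  rw [Prod.norm_def, Prod.norm_def, max_le_iff, max_le_iff]
  simp only [Real.norm_eq_abs, abs_le]
  exact ⟨⟨by linarith, by linarith⟩, ⟨by linarith, by linarith⟩, by linarith, by linarith⟩

/-- Failure of the Brunn–Minkowski inequality `BM(K,N)` in the sub-Finsler Heisenberg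
group equipped with a strictly convex `C^{1,1}` norm and a positive smooth measure. -/
theorem BM_fails_in_subFinsler_Heisenberg_C11
    (nrm : ℝ × ℝ → ℝ) (h1 : IsNorm2 nrm)
    (h2 : StrictConvexOn ℝ Set.univ fun x => (nrm x) ^ 2)
    (h3 : IsC11Away nrm)
    (f : ℝ × ℝ × ℝ → ℝ) (hf : ContDiff ℝ (⊤ : ℕ∞) f) (hfpos : ∀ p, 0 < f p)
    (K N : ℝ) (hN : 1 < N) :
    ∃ (A B : Set (ℝ × ℝ × ℝ)) (t : ℝ),
      A.Nonempty ∧ B.Nonempty ∧ MeasurableSet A ∧ MeasurableSet B ∧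
      t ∈ Set.Ioo (0:ℝ) 1 ∧
      (volume.withDensity fun p => ENNReal.ofReal (f p))
          (midpoints (dSF nrm) t A B) ^ (1 / N : ℝ) <
        tauCoeff K N (1 - t) (Theta (dSF nrm) K A B) *
            ((volume.withDensity fun p => ENNReal.ofReal (f p)) A) ^ (1 / N : ℝ) +
          tauCoeff K N t (Theta (dSF nrm) K A B) *
            ((volume.withDensity fun p => ENNReal.ofReal (f p)) B) ^ (1 / N : ℝ) := by
  obtain ⟨e, v, hd, he, hT⟩ := h1.exists_basis h2 h3
  have hv : v ≠ 0 := by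
    rintro rfl
    simp at hd
  obtain ⟨η, hη, hmid⟩ := exists_midpoint_mem_smallBox
  obtain ⟨s₀, hs₀, hup⟩ := h1.exists_upper_bound he hT hη
  obtain ⟨β₀, hβ₀, hlow⟩ := h1.exists_lower_bound he hv hT hη
  obtain ⟨ε, hε, hε1, hmid⟩ := hmid s₀ hs₀ β₀ hβ₀
  obtain ⟨θ₀, hθ₀, hτ⟩ := exists_lt_tauCoeff_half K hN
  have hf0 := hfpos 0
  obtain ⟨ρ, hρ, hfρ⟩ := Metric.continuousAt_iff.1 hf.continuous.continuousAt (f 0 / 20)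
    (by linarith)
  obtain ⟨r₀, hr₀, hsmall⟩ := exists_norm_heisEquiv_smul_lt e v 3 hρ
  obtain ⟨r, hr, hrle⟩ : ∃ r > (0 : ℝ), r ≤ min r₀ (θ₀ / 3) := ⟨_, by positivity, le_rfl⟩
  rw [le_min_iff] at hrle
  have hdr : (r • e).1 * (r • v).2 - (r • e).2 * (r • v).1 ≠ 0 := by
    have : (r • e).1 * (r • v).2 - (r • e).2 * (r • v).1 = r ^ 2 * (e.1 * v.2 - e.2 * v.1) := by
      simp only [Prod.smul_fst, Prod.smul_snd, smul_eq_mul]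
      ring
    rw [this]
    exact mul_ne_zero (by positivity) hd
  have hscale : ∀ x y : ℝ, nrm (x • r • e + y • r • v) = r * nrm (x • e + y • v) := fun x y => by
    rw [smul_comm x r, smul_comm y r, ← smul_add, h1.smul_eq, abs_of_pos hr]
  set Φ := heisEquiv (r • e) (r • v) hdr with hΦ
  have hbounds : ∀ p ∈ Metric.closedBall (0 : ℝ × ℝ × ℝ) 3,
      19 / 20 * f 0 ≤ f (Φ p) ∧ f (Φ p) ≤ 21 / 20 * f 0 := fun p hp => by
    have h := hfρ (x := Φ p) (by rw [dist_zero_right]; exact hsmall r hr hrle.1 hdr p hp)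
    rw [Real.dist_eq, abs_lt] at h
    constructor <;> linarith
  have hmid := hmid (fun p q => dSF nrm (Φ p) (Φ q) / r)
    (fun p q X Y Z hX hY hZ hX0 hs => by
      rw [div_le_iff₀' hr]
      refine dSF_le h1 hdr (s₀ := s₀) (fun x y hx hy => ?_) hX hY hZ hX0 hs
      rw [hscale]
      exact mul_le_mul_of_nonneg_left (hup x y hx hy) hr.le)
    (fun p q c₀ c₁ hD hc => by
      rw [le_div_iff₀' hr]
      refine calib_le_dSF h1 hdr hr hβ₀ (fun β hβ x y => ?_) (R := 5) ((div_lt_iff₀' hr).1 hD) hc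
      rw [hscale]
      exact mul_le_mul_of_nonneg_left (hlow β hβ x y) hr.le)
  obtain ⟨κ, hκ, hκ', hvol⟩ := volume_linearEquiv_image_smul Φ hε
  set A := Φ '' ((fun p => (-1, 0, 0) + ε • p) '' midBox) with hA
  set B := Φ '' ((fun p => (1, 0, 0) + ε • p) '' midBox) with hB
  set M := Φ '' ((fun p => 0 + ε • p) '' smallBox) with hM
  have hne : midBox.Nonempty := nonempty_Icc.2 (by simp [Prod.le_def])
  have hAm : MeasurableSet A :=
    (heisEquiv_image_isCompact Φ _ _ isCompact_Icc).isClosed.measurableSet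
  have hBm : MeasurableSet B :=
    (heisEquiv_image_isCompact Φ _ _ isCompact_Icc).isClosed.measurableSet
  have hMm : MeasurableSet M :=
    (heisEquiv_image_isCompact Φ _ _ isCompact_Icc).isClosed.measurableSet
  have hvolmid : volume midBox = ENNReal.ofReal 800 := by
    rw [midBox, volume_Icc_prod (by norm_num) (by norm_num)]
    norm_num
  have hvolsmall : volume smallBox ≤ ENNReal.ofReal 335 := by
    rw [smallBox, volume_Icc_prod (by norm_num) (by norm_num)]
    exact ENNReal.ofReal_le_ofReal (by norm_num)
  have hball : ∀ x : ℝ × ℝ × ℝ, ‖x‖ ≤ 1 → ∀ p ∈ midBox,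
      x + ε • p ∈ Metric.closedBall (0 : ℝ × ℝ × ℝ) 3 := fun x hx p hp =>
    norm_add_smul_le_three hε hε1 hx (norm_le_of_mem_Icc_neg (by norm_num) (by norm_num)
      (by norm_num) (by norm_num) (by norm_num) (by norm_num) hp)
  have hsub : midpoints (dSF nrm) (1 / 2) A B ⊆ M := by
    rintro x ⟨_, ⟨_, ⟨p, hp, rfl⟩, rfl⟩, _, ⟨_, ⟨q, hq, rfl⟩, rfl⟩, hx1, hx2⟩
    obtain ⟨m, rfl⟩ := Φ.surjective x
    obtain ⟨s, hs, hsm⟩ := (hmid p hp q hq).2 m (by simp only [hx1]; ring)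
      (by simp only [hx2]; ring)
    exact ⟨m, ⟨s, hs, (zero_add _).trans hsm⟩, rfl⟩
  have hΘ := Theta_mem_Icc (d := dSF nrm) (K := K) (R := θ₀) ((hne.image _).image Φ : A.Nonempty)
    ((hne.image _).image Φ : B.Nonempty) (by
      rintro _ ⟨_, ⟨p, hp, rfl⟩, rfl⟩ _ ⟨_, ⟨q, hq, rfl⟩, rfl⟩
      refine ⟨dSF_nonneg h1 _ _, ?_⟩
      have := (hmid p hp q hq).1
      rw [div_le_iff₀ hr] at this
      linarith)
  refine ⟨A, B, 1 / 2, (hne.image _).image _, (hne.image _).image _, hAm, hBm, by norm_num, ?_⟩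
  rw [show (1 - 1 / 2 : ℝ) = 1 / 2 by norm_num]
  have hlower : ∀ x : ℝ × ℝ × ℝ, ‖x‖ ≤ 1 → MeasurableSet (Φ '' ((fun p => x + ε • p) '' midBox)) →
      ENNReal.ofReal (760 * f 0) * κ ≤ (volume.withDensity fun p => ENNReal.ofReal (f p))
        (Φ '' ((fun p => x + ε • p) '' midBox)) := fun x hx hm => by
    refine le_trans (le_of_eq ?_) (le_withDensity_ofReal hm (c := 19 / 20 * f 0) ?_)
    · rw [hvol, hvolmid, mul_left_comm, ← ENNReal.ofReal_mul (by positivity), mul_comm]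
      ring_nf
    · rintro _ ⟨_, ⟨p, hp, rfl⟩, rfl⟩
      exact (hbounds _ (hball x hx p hp)).1
  refine rpow_lt_of_le_half hN (μ := ENNReal.ofReal (760 * f 0) * κ)
    (mul_ne_zero (ENNReal.ofReal_pos.2 (by positivity)).ne' hκ)
    (ENNReal.mul_ne_top ENNReal.ofReal_ne_top hκ')
    (hlower _ (by simp [Prod.norm_def]) hAm) (hlower _ (by simp [Prod.norm_def]) hBm) ?_
    (hτ _ hΘ.1 hΘ.2)
  calc _ ≤ (volume.withDensity fun p => ENNReal.ofReal (f p)) M := measure_mono hsub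
    _ ≤ ENNReal.ofReal (21 / 20 * f 0) * volume M := by
      refine withDensity_ofReal_le hMm ?_
      rintro _ ⟨_, ⟨p, hp, rfl⟩, rfl⟩
      exact (hbounds _ (norm_add_smul_le_three hε hε1 (by simp) (norm_le_of_mem_Icc_neg
        (by norm_num) (by norm_num) (by norm_num) (by norm_num) (by norm_num) (by norm_num) hp))).2
    _ ≤ ENNReal.ofReal (21 / 20 * f 0) * (κ * ENNReal.ofReal 335) := by
      rw [hM, hvol]
      gcongr
    _ = ENNReal.ofReal (21 / 20 * f 0 * 335) * κ := by
      rw [ENNReal.ofReal_mul (p := 21 / 20 * f 0) (by positivity), ← mul_assoc, mul_right_comm]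
    _ ≤ ENNReal.ofReal (1 / 2 * (760 * f 0)) * κ := by
      gcongr ?_ * _
      exact ENNReal.ofReal_le_ofReal (by linarith)
    _ = _ := by rw [ENNReal.ofReal_mul (by norm_num), mul_assoc]
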